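/- Let q be a prime power and S a surface of degree d in P^3 over F_q without F_q-plane components, with 2 ≤ d ≤ q+1 and N_q(S) = (d-1)q^2 + dq + 1. Then for every F_q-line l in P^3, the number of F_q-points of l lying on S equals the number of F_q-planes H containing l such that S ∩ H is a planar F_q-pencil of degree d. -/

import Mathlib

open MvPolynomial

variable {K : Type} [Field K]

/-- The linear form `∑ aᵢ Xᵢ` as a multivariate polynomial. -/
noncomputable def linForm {n : ℕ} (a : Fin n → K) : MvPolynomial (Fin n) K :=
  ∑ i, C (a i) * X i

/-- The linear form `v ↦ ∑ aᵢ vᵢ` as a linear map. -/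
noncomputable def linMap {n : ℕ} (a : Fin n → K) : (Fin n → K) →ₗ[K] K :=
  ∑ i, a i • LinearMap.proj i

/-- Substitution `F(M·X)` of a linear change of variables into `F`. -/
noncomputable def substLin {n : ℕ} (M : Matrix (Fin n) (Fin n) K)
    (F : MvPolynomial (Fin n) K) : MvPolynomial (Fin n) K :=
  MvPolynomial.aeval (fun i => ∑ j, C (M i j) * X j) F

/-- Projective equivalence over `K` of two forms. -/
def ProjEquiv {n : ℕ} (F G : MvPolynomial (Fin n) K) : Prop :=
  ∃ M : Matrix (Fin n) (Fin n) K, IsUnit M.det ∧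
    ∃ c : K, c ≠ 0 ∧ substLin M F = C c * G

/-- An `F_q`-line in `P^3` (resp. `P^2`), as a 2-dimensional linear subspace. -/
def IsLine {n : ℕ} (W : Submodule K (Fin n → K)) : Prop := Module.finrank K W = 2

/-- An `F_q`-plane in `P^3`, as a 3-dimensional linear subspace. -/
def IsPlane (W : Submodule K (Fin 4 → K)) : Prop := Module.finrank K W = 3

/-- The section `S ∩ H` of the surface `S = {F = 0}` with the plane `H` given by the
subspace `W` is a planar `F_q`-pencil of degree `d` with vertex `P`: modulo the linear
form defining `H`, `F` is a nonzero scalar times a product of `d` linear forms over `F_q`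
cutting out `d` pairwise distinct lines of `H`, all passing through the point `P`. -/
def IsPencil (F : MvPolynomial (Fin 4) K) (d : ℕ)
    (W : Submodule K (Fin 4 → K)) (P : Projectivization K (Fin 4 → K)) : Prop :=
  ∃ (a : Fin 4 → K) (m : Fin d → Fin 4 → K) (c : K) (g : MvPolynomial (Fin 4) K),
    a ≠ 0 ∧ W = LinearMap.ker (linMap a) ∧ c ≠ 0 ∧
    F = C c * (∏ i, linForm (m i)) + linForm a * g ∧
    (∀ i, IsLine (LinearMap.ker (linMap a) ⊓ LinearMap.ker (linMap (m i)))) ∧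
    (∀ i j, i ≠ j →
      LinearMap.ker (linMap a) ⊓ LinearMap.ker (linMap (m i)) ≠
      LinearMap.ker (linMap a) ⊓ LinearMap.ker (linMap (m j))) ∧
    P.rep ∈ W ∧ (∀ i, linMap (m i) P.rep = 0)

/-- The restriction of `F` to the plane `H` given by the subspace `W` has a linear
factor over `F_q` (i.e. the section `S ∩ H` has an `F_q`-line component). -/
def SectionHasLineComp (F : MvPolynomial (Fin 4) K)
    (W : Submodule K (Fin 4 → K)) : Prop :=
  ∃ (a b : Fin 4 → K) (h g : MvPolynomial (Fin 4) K),
    a ≠ 0 ∧ W = LinearMap.ker (linMap a) ∧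
    IsLine (LinearMap.ker (linMap a) ⊓ LinearMap.ker (linMap b)) ∧
    F = linForm b * h + linForm a * g


section Restriction

variable {n d : ℕ}

lemma linMap_apply (a v : Fin n → K) : linMap a v = ∑ i, a i * v i := by
  simp [linMap]

lemma aeval_linForm {A : Type*} [CommRing A] [Algebra K A] (a : Fin n → K) (x : Fin n → A) :
    aeval x (linForm a) = ∑ i, algebraMap K A (a i) * x i := by
  simp [linForm]

lemma eval_linForm (a v : Fin n → K) : eval v (linForm a) = linMap a v := by
  simp [linForm, linMap_apply]

lemma exists_linMap_eq (f : (Fin n → K) →ₗ[K] K) : ∃ a, linMap a = f := by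
  refine ⟨fun i => f (Pi.single i 1), LinearMap.pi_ext' fun i => LinearMap.ext_ring ?_⟩
  simp [linMap_apply, Pi.single_apply]

lemma linMap_injective : Function.Injective (linMap : (Fin n → K) → _) := by
  intro a b h
  funext i
  have := congrArg (fun f => f (Pi.single i 1)) h
  simpa [linMap_apply, Pi.single_apply] using this

lemma linForm_isHomogeneous (a : Fin n → K) : (linForm a).IsHomogeneous 1 :=
  IsHomogeneous.sum _ _ _ fun i _ => isHomogeneous_C_mul_X (a i) i

lemma MvPolynomial.IsHomogeneous.aeval_mul_left {A : Type*} [CommRing A] [Algebra K A]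
    {F : MvPolynomial (Fin n) K} (hF : F.IsHomogeneous d) (c : A) (x : Fin n → A) :
    MvPolynomial.aeval (fun i => c * x i) F = c ^ d * MvPolynomial.aeval x F := by
  rw [aeval_def, aeval_def, MvPolynomial.eval₂_eq', MvPolynomial.eval₂_eq', Finset.mul_sum]
  refine Finset.sum_congr rfl fun k hk => ?_
  have hdeg : ∑ i, k i = d := by
    have h := hF.degree_eq_sum_deg_support hk
    rw [h]
    exact (Finset.sum_subset (Finset.subset_univ _) fun i _ hi => by simpa using hi).symm
  simp only [mul_pow, Finset.prod_mul_distrib, Finset.prod_pow_eq_pow_sum, hdeg]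
  ring

lemma MvPolynomial.IsHomogeneous.eval_smul' {F : MvPolynomial (Fin n) K}
    (hF : F.IsHomogeneous d) (c : K) (v : Fin n → K) :
    eval (c • v) F = c ^ d * eval v F := by
  have := hF.aeval_mul_left c v
  rwa [aeval_eq_eval] at this

/-- The restriction `F(R + tQ)` of `F` to an affine line. -/
noncomputable def linePoly (F : MvPolynomial (Fin n) K) (R Q : Fin n → K) : Polynomial K :=
  aeval (fun i => Polynomial.C (R i) + Polynomial.C (Q i) * Polynomial.X) F

lemma aeval_linePoly {A : Type*} [CommRing A] [Algebra K A] (F : MvPolynomial (Fin n) K)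
    (R Q : Fin n → K) (t : A) :
    Polynomial.aeval t (linePoly F R Q) =
      aeval (fun i => algebraMap K A (R i) + algebraMap K A (Q i) * t) F := by
  rw [linePoly, ← AlgHom.comp_apply, comp_aeval]
  simp

lemma eval_linePoly (F : MvPolynomial (Fin n) K) (R Q : Fin n → K) (t : K) :
    (linePoly F R Q).eval t = eval (R + t • Q) F := by
  have := aeval_linePoly F R Q t
  rw [Polynomial.coe_aeval_eq_eval] at this
  rw [this, aeval_eq_eval]
  congr 2
  funext i
  simp [mul_comm]

open LaurentPolynomial in
lemma toLaurent_linePoly {F : MvPolynomial (Fin n) K} (hF : F.IsHomogeneous d)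
    (R Q : Fin n → K) :
    (linePoly F R Q).toLaurent = T d * invert (linePoly F Q R).toLaurent := by
  have h1 : (linePoly F R Q).toLaurent =
      aeval (fun i => LaurentPolynomial.C (R i) + LaurentPolynomial.C (Q i) * T 1) F := by
    rw [← Polynomial.toLaurentAlg_apply, linePoly, ← AlgHom.comp_apply, comp_aeval]
    simp
  have h2 : invert (linePoly F Q R).toLaurent =
      aeval (fun i => LaurentPolynomial.C (Q i) + LaurentPolynomial.C (R i) * T (-1)) F := by
    rw [← Polynomial.toLaurentAlg_apply, linePoly, ← AlgEquiv.coe_toAlgHom,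
      ← AlgHom.comp_apply, ← AlgHom.comp_apply, comp_aeval]
    simp
  rw [h1, h2]
  have h3 := hF.aeval_mul_left (T 1)
    (fun i => LaurentPolynomial.C (Q i) + LaurentPolynomial.C (R i) * T (-1))
  rw [T_pow] at h3
  simp only [mul_one] at h3
  rw [← h3]
  congr 2
  funext i
  have : (T 1 * T (-1) : LaurentPolynomial K) = 1 := by rw [← T_add]; simp
  linear_combination (-LaurentPolynomial.C (R i)) * this

lemma coeff_linePoly {F : MvPolynomial (Fin n) K} (hF : F.IsHomogeneous d)
    (R Q : Fin n → K) (k : ℕ) :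
    (linePoly F R Q).coeff k = if k ≤ d then (linePoly F Q R).coeff (d - k) else 0 := by
  have h := congrArg (fun f => f.coeff (k : ℤ)) (toLaurent_linePoly hF R Q)
  have hT : ∀ f : LaurentPolynomial K,
      (LaurentPolynomial.T (d : ℤ) * f).coeff (k : ℤ) = f.coeff (k - d) := fun f => by
    have := AddMonoidAlgebra.coeff_single_mul_add f (1 : K) (d : ℤ) (k - d)
    rwa [add_sub_cancel, one_mul] at this
  have hnat : ∀ (p : Polynomial K) (m : ℕ), p.toLaurent.coeff (m : ℤ) = p.coeff m := fun p m => by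
    rw [LaurentPolynomial.coeff_toLaurent]
    exact Finsupp.mapDomain_apply Nat.castEmbedding.injective _ m
  simp only [hT, hnat, LaurentPolynomial.invert_apply] at h
  rw [h]
  split_ifs with hk
  · rw [show -((k : ℤ) - d) = ((d - k : ℕ) : ℤ) by omega, hnat]
  · rw [← Finsupp.notMem_support_iff, LaurentPolynomial.support_coeff_toLaurent]
    simp only [Finset.mem_map, not_exists, not_and]
    intro m _ hm
    change (m : ℤ) = _ at hm
    omega

lemma exists_coeff_one_linePoly (F : MvPolynomial (Fin n) K) (Q : Fin n → K) :
    ∃ τ : (Fin n → K) →ₗ[K] K, ∀ R, (linePoly F Q R).coeff 1 = τ R := by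
  induction F using MvPolynomial.induction_on with
  | C a => exact ⟨0, fun R => by simp [linePoly]⟩
  | add p q hp hq =>
    obtain ⟨τ, hτ⟩ := hp
    obtain ⟨σ, hσ⟩ := hq
    refine ⟨τ + σ, fun R => ?_⟩
    rw [LinearMap.add_apply, ← hτ, ← hσ]
    simp [linePoly]
  | mul_X p i hp =>
    obtain ⟨τ, hτ⟩ := hp
    refine ⟨Q i • τ + eval Q p • LinearMap.proj i, fun R => ?_⟩
    have h0 : (linePoly p Q R).coeff 0 = eval Q p := by
      rw [Polynomial.coeff_zero_eq_eval_zero, eval_linePoly]; simp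
    have : linePoly (p * X i) Q R =
        linePoly p Q R * Polynomial.C (Q i) +
          (linePoly p Q R * Polynomial.C (R i)) * Polynomial.X := by
      simp [linePoly]; ring
    rw [this, Polynomial.coeff_add, Polynomial.coeff_mul_C, Polynomial.coeff_mul_X,
      Polynomial.coeff_mul_C, h0, hτ]
    simp [mul_comm]

lemma natDegree_linePoly_lt {F : MvPolynomial (Fin n) K} (hF : F.IsHomogeneous d)
    {R Q : Fin n → K} (hQ : eval Q F = 0) (h0 : linePoly F R Q ≠ 0) :
    (linePoly F R Q).natDegree < d := by
  rw [← not_le]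
  intro h
  have h1 := coeff_linePoly hF R Q (linePoly F R Q).natDegree
  rw [Polynomial.coeff_natDegree] at h1
  split_ifs at h1 with h2
  · rw [le_antisymm h2 h, Nat.sub_self, Polynomial.coeff_zero_eq_eval_zero, eval_linePoly] at h1
    simp [hQ] at h1
    exact h0 h1
  · exact h0 (Polynomial.leadingCoeff_eq_zero.mp h1)

lemma natDegree_linePoly_add_one_lt {F : MvPolynomial (Fin n) K} (hF : F.IsHomogeneous d)
    {R Q : Fin n → K} (hQ : eval Q F = 0) (hR : (linePoly F Q R).coeff 1 = 0)
    (h0 : linePoly F R Q ≠ 0) :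
    (linePoly F R Q).natDegree + 1 < d := by
  have h := natDegree_linePoly_lt hF hQ h0
  refine lt_of_le_of_ne h fun h' => h0 ?_
  have h1 := coeff_linePoly hF R Q (linePoly F R Q).natDegree
  rw [Polynomial.coeff_natDegree, if_pos h.le,
    show d - (linePoly F R Q).natDegree = 1 by omega, hR] at h1
  exact Polynomial.leadingCoeff_eq_zero.mp h1

end Restriction

section Factorization

variable {n d : ℕ}

lemma linForm_add (a b : Fin n → K) : linForm (a + b) = linForm a + linForm b := by
  simp [linForm, add_mul, Finset.sum_add_distrib]

lemma linForm_smul (c : K) (a : Fin n → K) : linForm (c • a) = C c * linForm a := by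
  simp [linForm, mul_assoc, Finset.mul_sum]

lemma linForm_single (i : Fin n) : linForm (Pi.single i (1 : K)) = X i := by
  rw [linForm, Finset.sum_eq_single i] <;> simp +contextual

/-- The restriction `F(sR + tQ)` of `F` to the span of two vectors. -/
noncomputable def restrictSpan (R Q : Fin n → K) :
    MvPolynomial (Fin n) K →ₐ[K] MvPolynomial (Fin 2) K :=
  aeval (fun i => C (R i) * X 0 + C (Q i) * X 1)

lemma restrictSpan_linForm (R Q a : Fin n → K) :
    restrictSpan R Q (linForm a) = C (linMap a R) * X 0 + C (linMap a Q) * X 1 := by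
  simp only [restrictSpan, aeval_linForm, linMap_apply, map_sum, map_mul, Finset.sum_mul,
    algebraMap_eq, ← Finset.sum_add_distrib]
  exact Finset.sum_congr rfl fun i _ => by ring

lemma restrictSpan_linForm_eq_zero_iff (R Q a : Fin n → K) :
    restrictSpan R Q (linForm a) = 0 ↔ linMap a R = 0 ∧ linMap a Q = 0 := by
  rw [restrictSpan_linForm]
  refine ⟨fun h => ⟨?_, ?_⟩, fun h => by simp [h.1, h.2]⟩
  · simpa using congrArg (eval ![1, 0]) h
  · simpa using congrArg (eval ![0, 1]) h

lemma restrictSpan_eq_zero_of_linePoly {F : MvPolynomial (Fin n) K} (hF : F.IsHomogeneous d)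
    {R Q : Fin n → K} (h : linePoly F R Q = 0) : restrictSpan R Q F = 0 := by
  let L := FractionRing (MvPolynomial (Fin 2) K)
  have hinj : Function.Injective (algebraMap (MvPolynomial (Fin 2) K) L) :=
    IsFractionRing.injective _ _
  refine hinj ?_
  set s := algebraMap (MvPolynomial (Fin 2) K) L (X 0) with hs
  set t := algebraMap (MvPolynomial (Fin 2) K) L (X 1) with ht
  have hs0 : s ≠ 0 := by
    rw [hs, Ne, map_eq_zero_iff _ hinj]
    exact X_ne_zero 0
  have h1 : algebraMap (MvPolynomial (Fin 2) K) L (restrictSpan R Q F) =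
      aeval (fun i => s * (algebraMap K L (R i) + algebraMap K L (Q i) * (t / s))) F := by
    have hcomp : ∀ p, algebraMap (MvPolynomial (Fin 2) K) L p =
        IsScalarTower.toAlgHom K (MvPolynomial (Fin 2) K) L p := fun _ => rfl
    rw [hcomp, restrictSpan, ← AlgHom.comp_apply, comp_aeval]
    congr 2
    funext i
    rw [← hcomp, map_add, map_mul, map_mul, ← algebraMap_eq,
      ← IsScalarTower.algebraMap_apply, ← IsScalarTower.algebraMap_apply, ← hs, ← ht,
      mul_add, mul_left_comm, mul_div_cancel₀ _ hs0, mul_comm s]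
  rw [h1, hF.aeval_mul_left, ← aeval_linePoly, h, map_zero, map_zero, mul_zero]

lemma linePoly_eq_zero_of_restrictSpan {F : MvPolynomial (Fin n) K} {R Q : Fin n → K}
    (h : restrictSpan R Q F = 0) (α β γ δ : K) :
    linePoly F (α • R + β • Q) (γ • R + δ • Q) = 0 := by
  have : linePoly F (α • R + β • Q) (γ • R + δ • Q) =
      aeval ![Polynomial.C α + Polynomial.C γ * Polynomial.X,
        Polynomial.C β + Polynomial.C δ * Polynomial.X] (restrictSpan R Q F) := by
    rw [restrictSpan, ← AlgHom.comp_apply, comp_aeval, linePoly]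
    congr 2
    funext i
    simp [algHom_C]
    ring
  rw [this, h, map_zero]

/-- `F` restricts to the zero polynomial on every line contained in `W`. -/
def VanishesOn (F : MvPolynomial (Fin n) K) (W : Submodule K (Fin n → K)) : Prop :=
  ∀ R ∈ W, ∀ Q ∈ W, linePoly F R Q = 0

lemma vanishesOn_span_pair {F : MvPolynomial (Fin n) K} (hF : F.IsHomogeneous d)
    {R Q : Fin n → K} (h : linePoly F R Q = 0) :
    VanishesOn F (Submodule.span K {R, Q}) := by
  intro R' hR' Q' hQ'
  obtain ⟨α, β, rfl⟩ := Submodule.mem_span_pair.mp hR'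
  obtain ⟨γ, δ, rfl⟩ := Submodule.mem_span_pair.mp hQ'
  exact linePoly_eq_zero_of_restrictSpan (restrictSpan_eq_zero_of_linePoly hF h) α β γ δ

lemma VanishesOn.eval_eq_zero {F : MvPolynomial (Fin n) K} {W : Submodule K (Fin n → K)}
    (h : VanishesOn F W) {v : Fin n → K} (hv : v ∈ W) : eval v F = 0 := by
  have := eval_linePoly F v 0 0
  rw [h v hv 0 W.zero_mem] at this
  simpa using this.symm

lemma IsLine.exists_basis {W : Submodule K (Fin n → K)} (h : IsLine W) :
    ∃ R Q, LinearIndependent K ![R, Q] ∧ Submodule.span K {R, Q} = W := by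
  let b := Module.finBasisOfFinrankEq K W h
  refine ⟨b 0, b 1, ?_, ?_⟩
  · have := b.linearIndependent.map' W.subtype (by simp)
    rwa [show W.subtype ∘ b = ![(b 0 : Fin n → K), b 1] from
      funext fun i => by fin_cases i <;> rfl] at this
  · have := congrArg (Submodule.map W.subtype) b.span_eq
    rw [Submodule.map_span, Submodule.map_top, Submodule.range_subtype] at this
    refine Eq.trans (congrArg _ ?_) this
    ext x
    simp [Fin.exists_fin_two, eq_comm]

lemma exists_eq_linForm_mul_add {a b R Q : Fin n → K} (hRQ : LinearIndependent K ![R, Q])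
    (hab : LinearMap.ker (linMap a) ⊓ LinearMap.ker (linMap b) ≤ Submodule.span K {R, Q})
    {h : MvPolynomial (Fin n) K} (hh : restrictSpan R Q h = 0) :
    ∃ h' g, h = linForm b * h' + linForm a * g := by
  set I : Ideal (MvPolynomial (Fin n) K) := Ideal.span {linForm b, linForm a} with hI
  suffices h ∈ I by
    obtain ⟨x, y, hxy⟩ := Ideal.mem_span_pair.mp this
    exact ⟨x, y, by rw [← hxy]; ring⟩
  obtain ⟨f, hf⟩ : ∃ f : (Fin n → K) →ₗ[K] (Fin 2 → K),
      f ∘ₗ Fintype.linearCombination K ![R, Q] = LinearMap.id :=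
    LinearMap.exists_leftInverse_of_injective _
      (LinearMap.ker_eq_bot.mpr hRQ.fintypeLinearCombination_injective)
  have hfR : f R = Pi.single 0 1 := by
    have := LinearMap.congr_fun hf (Pi.single 0 1)
    simpa [Fintype.linearCombination_apply_single] using this
  have hfQ : f Q = Pi.single 1 1 := by
    have := LinearMap.congr_fun hf (Pi.single 1 1)
    simpa [Fintype.linearCombination_apply_single] using this
  obtain ⟨b₀, hb₀⟩ := exists_linMap_eq (LinearMap.proj 0 ∘ₗ f)
  obtain ⟨b₁, hb₁⟩ := exists_linMap_eq (LinearMap.proj 1 ∘ₗ f)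
  have hmem : ∀ i, X i - (C (R i) * linForm b₀ + C (Q i) * linForm b₁) ∈ I := by
    intro i
    set m : Fin n → K := Pi.single i 1 + (-(R i)) • b₀ + (-(Q i)) • b₁ with hm
    have hmf : X i - (C (R i) * linForm b₀ + C (Q i) * linForm b₁) = linForm m := by
      rw [hm, linForm_add, linForm_add, linForm_smul, linForm_smul, linForm_single]
      simp only [map_neg]
      ring
    have hmap : ∀ v, linMap m v = v i - R i * f v 0 - Q i * f v 1 := by
      intro v
      have h0 := LinearMap.congr_fun hb₀ v
      have h1 := LinearMap.congr_fun hb₁ v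
      simp only [LinearMap.comp_apply, LinearMap.proj_apply, linMap_apply] at h0 h1
      rw [← h0, ← h1, linMap_apply, hm]
      simp [add_mul, Finset.sum_add_distrib, Finset.mul_sum, mul_assoc, Pi.single_apply]
      ring
    have hker : ⨅ j, LinearMap.ker (![linMap a, linMap b] j) ≤ LinearMap.ker (linMap m) := by
      intro v hv
      have hv' : v ∈ Submodule.span K {R, Q} := by
        refine hab ?_
        simpa [Submodule.mem_iInf, Fin.forall_fin_two] using hv
      obtain ⟨α, β, rfl⟩ := Submodule.mem_span_pair.mp hv'
      rw [LinearMap.mem_ker, hmap, map_add, map_smul, map_smul, hfR, hfQ]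
      simp
      ring
    have hspan := mem_span_of_iInf_ker_le_ker hker
    rw [Matrix.range_cons, Matrix.range_cons, Matrix.range_empty, Set.union_empty,
      Set.singleton_union, Submodule.mem_span_pair] at hspan
    obtain ⟨α, β, hαβ⟩ := hspan
    have hmab : m = α • a + β • b := by
      refine linMap_injective ?_
      rw [← hαβ]
      ext v
      simp [linMap_apply, Pi.single_apply]
    rw [hmf, hmab, linForm_add, linForm_smul, linForm_smul]
    exact I.add_mem (I.mul_mem_left _ (Ideal.subset_span (by simp)))
      (I.mul_mem_left _ (Ideal.subset_span (by simp)))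
  rw [← Ideal.Quotient.eq_zero_iff_mem]
  have h1 : Ideal.Quotient.mkₐ K I = (Ideal.Quotient.mkₐ K I).comp
      ((aeval ![linForm b₀, linForm b₁]).comp (restrictSpan R Q)) := by
    refine algHom_ext fun i => ?_
    have := Ideal.Quotient.eq.mpr (hmem i)
    simpa [restrictSpan, algHom_C] using this
  have h2 := AlgHom.congr_fun h1 h
  rw [AlgHom.comp_apply, AlgHom.comp_apply, hh, map_zero, map_zero] at h2
  exact h2

lemma exists_eq_prod_linForm_mul_add {F : MvPolynomial (Fin n) K} (hF : F.IsHomogeneous d)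
    {a : Fin n → K} {ι : Type*} (s : Finset ι) (m : ι → Fin n → K)
    (hline : ∀ i ∈ s, IsLine (LinearMap.ker (linMap a) ⊓ LinearMap.ker (linMap (m i))))
    (hinj : ∀ i ∈ s, ∀ j ∈ s, i ≠ j → LinearMap.ker (linMap a) ⊓ LinearMap.ker (linMap (m i)) ≠
      LinearMap.ker (linMap a) ⊓ LinearMap.ker (linMap (m j)))
    (hvan : ∀ i ∈ s, VanishesOn F (LinearMap.ker (linMap a) ⊓ LinearMap.ker (linMap (m i)))) :
    ∃ h g, F = (∏ i ∈ s, linForm (m i)) * h + linForm a * g := by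
  classical
  induction s using Finset.induction_on with
  | empty => exact ⟨F, 0, by simp⟩
  | insert i s his ih =>
    obtain ⟨h, g, hFg⟩ := ih (fun j hj => hline j (by simp [hj]))
      (fun j hj k hk => hinj j (by simp [hj]) k (by simp [hk])) (fun j hj => hvan j (by simp [hj]))
    have hi := hline i (by simp)
    obtain ⟨R, Q, hRQ, hspan⟩ := hi.exists_basis
    have hR : R ∈ LinearMap.ker (linMap a) ⊓ LinearMap.ker (linMap (m i)) :=
      hspan ▸ Submodule.subset_span (by simp)
    have hQ : Q ∈ LinearMap.ker (linMap a) ⊓ LinearMap.ker (linMap (m i)) :=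
      hspan ▸ Submodule.subset_span (by simp)
    have hFRQ := restrictSpan_eq_zero_of_linePoly hF (hvan i (by simp) R hR Q hQ)
    have ha : restrictSpan R Q (linForm a) = 0 :=
      (restrictSpan_linForm_eq_zero_iff R Q a).mpr ⟨hR.1, hQ.1⟩
    rw [hFg, map_add, map_mul, map_mul, ha, zero_mul, add_zero, map_prod] at hFRQ
    have hh : restrictSpan R Q h = 0 := by
      refine (mul_eq_zero.mp hFRQ).resolve_left ?_
      refine Finset.prod_ne_zero_iff.mpr fun j hj hj0 => ?_
      rw [restrictSpan_linForm_eq_zero_iff] at hj0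
      refine hinj i (by simp) j (by simp [hj]) (by rintro rfl; exact his hj) ?_
      refine Submodule.eq_of_le_of_finrank_eq ?_ (hi.trans (hline j (by simp [hj])).symm)
      rw [← hspan, Submodule.span_le]
      rintro x (rfl | rfl)
      · exact ⟨hR.1, hj0.1⟩
      · exact ⟨hQ.1, hj0.2⟩
    obtain ⟨h', g', hh'⟩ := exists_eq_linForm_mul_add hRQ hspan.ge hh
    refine ⟨h', (∏ j ∈ s, linForm (m j)) * g' + g, ?_⟩
    rw [Finset.prod_insert his, hFg, hh']
    ring

lemma homogeneousComponent_mul_of_le {P : MvPolynomial (Fin n) K} {r k : ℕ}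
    (hP : P.IsHomogeneous r) (h : r ≤ k) (G : MvPolynomial (Fin n) K) :
    homogeneousComponent k (P * G) = P * homogeneousComponent (k - r) G := by
  let := gradedAlgebra (σ := Fin n) (R := K)
  rw [← decomposition.decompose'_apply, ← decomposition.decompose'_apply]
  exact DirectSum.coe_decompose_mul_of_left_mem_of_le (homogeneousSubmodule (Fin n) K) hP h

lemma homogeneousComponent_mul_of_lt {P : MvPolynomial (Fin n) K} {r k : ℕ}
    (hP : P.IsHomogeneous r) (h : k < r) (G : MvPolynomial (Fin n) K) :
    homogeneousComponent k (P * G) = 0 := by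
  let := gradedAlgebra (σ := Fin n) (R := K)
  rw [← decomposition.decompose'_apply]
  exact DirectSum.coe_decompose_mul_of_left_mem_of_not_le (homogeneousSubmodule (Fin n) K) hP
    h.not_ge

lemma card_le_and_eq_prod_of_vanishesOn {F : MvPolynomial (Fin n) K} (hF : F.IsHomogeneous d)
    (hd : 1 ≤ d) {a : Fin n → K} (haF : ¬ linForm a ∣ F) {ι : Type*} (s : Finset ι)
    (m : ι → Fin n → K)
    (hline : ∀ i ∈ s, IsLine (LinearMap.ker (linMap a) ⊓ LinearMap.ker (linMap (m i))))
    (hinj : ∀ i ∈ s, ∀ j ∈ s, i ≠ j → LinearMap.ker (linMap a) ⊓ LinearMap.ker (linMap (m i)) ≠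
      LinearMap.ker (linMap a) ⊓ LinearMap.ker (linMap (m j)))
    (hvan : ∀ i ∈ s, VanishesOn F (LinearMap.ker (linMap a) ⊓ LinearMap.ker (linMap (m i)))) :
    s.card ≤ d ∧ (s.card = d →
      ∃ c g, c ≠ 0 ∧ F = C c * (∏ i ∈ s, linForm (m i)) + linForm a * g) := by
  obtain ⟨h, g, hFg⟩ := exists_eq_prod_linForm_mul_add hF s m hline hinj hvan
  have hP : (∏ i ∈ s, linForm (m i)).IsHomogeneous s.card := by
    have := IsHomogeneous.prod s (fun i => linForm (m i)) (fun _ => 1)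
      (fun i _ => linForm_isHomogeneous (m i))
    simpa using this
  have hFd := homogeneousComponent_eq_self hF
  rw [hFg, map_add, homogeneousComponent_mul_of_le (linForm_isHomogeneous a) hd, ← hFg] at hFd
  constructor
  · by_contra! hlt
    rw [homogeneousComponent_mul_of_lt hP hlt, zero_add] at hFd
    exact haF ⟨_, hFd.symm⟩
  · intro hcard
    rw [homogeneousComponent_mul_of_le hP hcard.le, hcard, Nat.sub_self,
      homogeneousComponent_zero] at hFd
    refine ⟨coeff 0 h, _, fun hc => haF ?_, by rw [mul_comm (C _)]; exact hFd.symm⟩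
    rw [hc, map_zero, mul_zero, zero_add] at hFd
    exact ⟨_, hFd.symm⟩

end Factorization

section Counting

open scoped Classical

variable {n d : ℕ} [Fintype K]

/-- The finite set of vectors of a subspace. -/
noncomputable def vectors (W : Submodule K (Fin n → K)) : Finset (Fin n → K) :=
  Finset.univ.filter (· ∈ W)

/-- The zeros of `F` in a subspace. -/
noncomputable def zeros (F : MvPolynomial (Fin n) K) (W : Submodule K (Fin n → K)) :
    Finset (Fin n → K) :=
  (vectors W).filter fun v => eval v F = 0

/-- The parameters `t` with `F(R + tQ) = 0`. -/
noncomputable def affZeros (F : MvPolynomial (Fin n) K) (R Q : Fin n → K) : Finset K :=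
  Finset.univ.filter fun t => eval (R + t • Q) F = 0

@[simp] lemma mem_vectors {W : Submodule K (Fin n → K)} {v : Fin n → K} :
    v ∈ vectors W ↔ v ∈ W := by simp [vectors]

@[simp] lemma mem_zeros {F : MvPolynomial (Fin n) K} {W : Submodule K (Fin n → K)}
    {v : Fin n → K} : v ∈ zeros F W ↔ v ∈ W ∧ eval v F = 0 := by simp [zeros]

@[simp] lemma mem_affZeros {F : MvPolynomial (Fin n) K} {R Q : Fin n → K} {t : K} :
    t ∈ affZeros F R Q ↔ eval (R + t • Q) F = 0 := by simp [affZeros]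

lemma card_vectors (W : Submodule K (Fin n → K)) :
    (vectors W).card = Fintype.card K ^ Module.finrank K W := by
  rw [← Nat.card_eq_fintype_card, ← Module.natCard_eq_pow_finrank (K := K) (V := W),
    Nat.card_eq_fintype_card, Fintype.card_subtype]
  rfl

lemma vectors_mono {U W : Submodule K (Fin n → K)} (h : U ≤ W) : vectors U ⊆ vectors W :=
  fun _ hv => mem_vectors.mpr (h (mem_vectors.mp hv))

lemma vectors_inter (U W : Submodule K (Fin n → K)) :
    vectors U ∩ vectors W = vectors (U ⊓ W) := by
  ext; simp

lemma card_mul_card_zeros (F : MvPolynomial (Fin n) K) {W : Submodule K (Fin n → K)}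
    {Q : Fin n → K} (hQ : Q ∈ W) :
    Fintype.card K * (zeros F W).card = ∑ R ∈ vectors W, (affZeros F R Q).card := by
  have h : ∀ t : K, (zeros F W).card =
      ∑ R ∈ vectors W, if eval (R + t • Q) F = 0 then 1 else 0 := by
    intro t
    rw [← Finset.card_filter]
    refine (Finset.card_bij' (fun R _ => R + t • Q) (fun R _ => R - t • Q) ?_ ?_ ?_ ?_).symm
    · intro R hR
      simp only [Finset.mem_filter, mem_vectors, mem_zeros] at hR ⊢
      exact ⟨W.add_mem hR.1 (W.smul_mem t hQ), hR.2⟩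
    · intro R hR
      simp only [Finset.mem_filter, mem_vectors, mem_zeros, sub_add_cancel] at hR ⊢
      exact ⟨W.sub_mem hR.1 (W.smul_mem t hQ), hR.2⟩
    · simp
    · simp
  calc Fintype.card K * (zeros F W).card = ∑ _t : K, (zeros F W).card := by simp
    _ = ∑ t : K, ∑ R ∈ vectors W, if eval (R + t • Q) F = 0 then 1 else 0 :=
      Finset.sum_congr rfl fun t _ => h t
    _ = _ := by
      rw [Finset.sum_comm]
      exact Finset.sum_congr rfl fun R _ => by rw [affZeros, Finset.card_filter]

lemma card_affZeros_le_natDegree {F : MvPolynomial (Fin n) K} {R Q : Fin n → K}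
    (h0 : linePoly F R Q ≠ 0) : (affZeros F R Q).card ≤ (linePoly F R Q).natDegree := by
  refine Polynomial.card_le_degree_of_subset_roots fun t ht => ?_
  rw [Polynomial.mem_roots h0, Polynomial.IsRoot, eval_linePoly]
  exact mem_affZeros.mp ht

lemma card_affZeros_of_mem_span {F : MvPolynomial (Fin n) K} (hF : F.IsHomogeneous d)
    {R Q : Fin n → K} (hQ : eval Q F = 0) (hR : R ∈ Submodule.span K {Q}) :
    (affZeros F R Q).card = Fintype.card K := by
  obtain ⟨c, rfl⟩ := Submodule.mem_span_singleton.mp hR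
  rw [affZeros, Finset.filter_true_of_mem, Finset.card_univ]
  intro t _
  rw [← add_smul, hF.eval_smul', hQ, mul_zero]

lemma pow_finrank_le_card_inf_ker (W : Submodule K (Fin n → K)) (τ : (Fin n → K) →ₗ[K] K) {k : ℕ}
    (hW : Module.finrank K W = k + 1) :
    Fintype.card K ^ k ≤ (vectors (W ⊓ LinearMap.ker τ)).card := by
  rw [card_vectors]
  refine Nat.pow_le_pow_right Fintype.card_pos ?_
  have h1 := Submodule.finrank_sup_add_finrank_inf_eq W (LinearMap.ker τ)
  have h2 := LinearMap.finrank_range_add_finrank_ker τ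
  have h3 := Submodule.finrank_le (LinearMap.range τ)
  have h4 := Submodule.finrank_le (W ⊔ LinearMap.ker τ)
  rw [Module.finrank_self] at h3
  omega

lemma card_zeros_add_le {F : MvPolynomial (Fin n) K} (hF : F.IsHomogeneous d) (hd : 1 ≤ d)
    (hdq : d ≤ Fintype.card K + 1) {W : Submodule K (Fin n → K)} {k : ℕ}
    (hW : Module.finrank K W = k + 2) {Q : Fin n → K} (hQW : Q ∈ W) (hQ0 : Q ≠ 0)
    (hQ : eval Q F = 0)
    (hne : ∀ R ∈ W, R ∉ Submodule.span K {Q} → linePoly F R Q ≠ 0) :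
    (zeros F W).card + Fintype.card K ^ k + d ≤
      (d - 1) * Fintype.card K ^ (k + 1) + Fintype.card K + 2 := by
  obtain ⟨τ, hτ⟩ := exists_coeff_one_linePoly F Q
  set q := Fintype.card K with hq
  have hq0 : 0 < q := Fintype.card_pos
  have hterm : ∀ R ∈ vectors W, (affZeros F R Q).card + (if τ R = 0 then 1 else 0) ≤
      (d - 1) + if R ∈ Submodule.span K {Q} then q + 2 - d else 0 := by
    intro R hR
    split_ifs with h1 h2 h2
    · have := card_affZeros_of_mem_span hF hQ h2
      omega
    · have h0 := hne R (mem_vectors.mp hR) h2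
      have := card_affZeros_le_natDegree h0
      have := natDegree_linePoly_add_one_lt hF hQ (by rw [hτ, h1]) h0
      omega
    · have := card_affZeros_of_mem_span hF hQ h2
      omega
    · have h0 := hne R (mem_vectors.mp hR) h2
      have := card_affZeros_le_natDegree h0
      have := natDegree_linePoly_lt hF hQ h0
      omega
  have hsum := Finset.sum_le_sum hterm
  rw [Finset.sum_add_distrib, Finset.sum_add_distrib, ← card_mul_card_zeros F hQW,
    ← Finset.card_filter, ← Finset.sum_filter, Finset.sum_const, Finset.sum_const,
    card_vectors, hW, smul_eq_mul, smul_eq_mul] at hsum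
  have h1 : (vectors W).filter (fun R => τ R = 0) = vectors (W ⊓ LinearMap.ker τ) := by
    ext; simp
  have h2 : (vectors W).filter (· ∈ Submodule.span K {Q}) = vectors (Submodule.span K {Q}) := by
    ext v
    simp only [Finset.mem_filter, mem_vectors, and_iff_right_iff_imp]
    exact fun hv => (Submodule.span_singleton_le_iff_mem Q W).mpr hQW hv
  have h3 := pow_finrank_le_card_inf_ker W τ (k := k + 1) hW
  rw [h1, h2, card_vectors (Submodule.span K {Q}), finrank_span_singleton hQ0, pow_one] at hsum
  refine Nat.le_of_mul_le_mul_left ?_ hq0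
  obtain ⟨e, he⟩ := Nat.exists_eq_add_of_le (show d ≤ q + 2 by omega)
  rw [he, Nat.add_sub_cancel_left] at hsum
  have : q * ((d - 1) * q ^ (k + 1) + q + 2) = q ^ (k + 2) * (d - 1) + q * (d + e) := by
    rw [← he]; ring
  rw [this]
  rw [← hq] at h3 hsum
  calc q * ((zeros F W).card + q ^ k + d)
      = q * (zeros F W).card + q ^ (k + 1) + q * d := by ring
    _ ≤ q * (zeros F W).card + (vectors (W ⊓ LinearMap.ker τ)).card + q * d := by gcongr
    _ ≤ q ^ (k + 2) * (d - 1) + q * e + q * d := by gcongr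
    _ = _ := by ring

lemma pairwiseDisjoint_of_sum_card_le {ι α : Type*} [DecidableEq α] (s : Finset ι) (f : ι → Finset α)
    (h : ∑ i ∈ s, (f i).card ≤ (s.biUnion f).card) : (s : Set ι).PairwiseDisjoint f := by
  have hcount : ∑ i ∈ s, (f i).card =
      ∑ x ∈ s.biUnion f, (s.filter fun i => x ∈ f i).card := by
    have := Finset.sum_card_bipartiteAbove_eq_sum_card_bipartiteBelow (s := s)
      (t := s.biUnion f) (fun i x => x ∈ f i)
    refine Eq.trans ?_ this
    refine Finset.sum_congr rfl fun i hi => congrArg _ ?_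
    ext x
    simp only [Finset.bipartiteAbove, Finset.mem_filter, Finset.mem_biUnion]
    exact ⟨fun hx => ⟨⟨i, hi, hx⟩, hx⟩, fun hx => hx.2⟩
  have hpos : ∀ x ∈ s.biUnion f, 1 ≤ (s.filter fun i => x ∈ f i).card := by
    intro x hx
    obtain ⟨i, hi, hxi⟩ := Finset.mem_biUnion.mp hx
    exact Finset.card_pos.mpr ⟨i, by simp [hi, hxi]⟩
  rw [hcount, Finset.card_eq_sum_ones] at h
  have heq := (Finset.sum_eq_sum_iff_of_le hpos).mp (le_antisymm (Finset.sum_le_sum hpos) h)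
  intro i hi j hj hij
  refine Finset.disjoint_left.mpr fun x hxi hxj => hij ?_
  have h1 := heq x (Finset.mem_biUnion.mpr ⟨i, hi, hxi⟩)
  exact Finset.card_le_one.mp h1.ge i (by simpa [hxi] using hi) j (by simpa [hxj] using hj)

end Counting

section Planes

variable {n d : ℕ}

lemma finrank_inf_add_one {U V W : Submodule K (Fin n → K)} {k : ℕ} (hU : U ≤ W) (hV : V ≤ W)
    (hUk : Module.finrank K U = k) (hVk : Module.finrank K V = k)
    (hW : Module.finrank K W = k + 1) (hne : U ≠ V) :
    Module.finrank K ↥(U ⊓ V) + 1 = k := by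
  have h1 := Submodule.finrank_sup_add_finrank_inf_eq U V
  have h2 := Submodule.finrank_mono (sup_le hU hV)
  have h3 : Module.finrank K U < Module.finrank K ↥(U ⊔ V) := by
    refine Submodule.finrank_lt_finrank_of_lt (lt_of_le_of_ne le_sup_left fun h => hne ?_)
    have hVU : V ≤ U := by rw [h]; exact le_sup_right
    exact (Submodule.eq_of_le_of_finrank_eq hVU (hVk.trans hUk.symm)).symm
  omega

lemma finrank_sup_span_singleton {U : Submodule K (Fin n → K)} {R : Fin n → K} (hR : R ∉ U) :
    Module.finrank K ↥(U ⊔ Submodule.span K {R}) = Module.finrank K U + 1 := by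
  have h1 := Submodule.finrank_sup_add_finrank_inf_eq U (Submodule.span K {R})
  have hR0 : R ≠ 0 := fun h => hR (h ▸ U.zero_mem)
  have h2 : U ⊓ Submodule.span K {R} = ⊥ := by
    rw [← disjoint_iff, Submodule.disjoint_span_singleton' hR0]
    exact hR
  rw [h2, finrank_bot, finrank_span_singleton hR0] at h1
  omega

lemma finrank_ker_linMap {a : Fin 4 → K} (ha : a ≠ 0) :
    Module.finrank K (LinearMap.ker (linMap a)) = 3 := by
  have h0 : linMap a ≠ 0 := fun h => ha (linMap_injective (h.trans (by ext; simp [linMap_apply])))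
  have h := Module.Dual.finrank_ker_add_one_of_ne_zero h0
  rw [Module.finrank_fin_fun] at h
  omega

lemma exists_linMap_of_notMem {U : Submodule K (Fin n → K)} {R : Fin n → K} (hR : R ∉ U) :
    ∃ m, linMap m R ≠ 0 ∧ U ≤ LinearMap.ker (linMap m) := by
  obtain ⟨f, hf, hU⟩ := Submodule.exists_le_ker_of_notMem hR
  obtain ⟨m, rfl⟩ := exists_linMap_eq f
  exact ⟨m, hf, hU⟩

lemma exists_notMem_of_finrank_lt {U W : Submodule K (Fin n → K)}
    (h : Module.finrank K U < Module.finrank K W) : ∃ R ∈ W, R ∉ U := by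
  by_contra! hle
  exact absurd (Submodule.finrank_mono (show W ≤ U from hle)) h.not_ge

lemma IsPlane.exists_eq_ker {H : Submodule K (Fin 4 → K)} (hH : IsPlane H) :
    ∃ a, a ≠ 0 ∧ H = LinearMap.ker (linMap a) := by
  obtain ⟨R, -, hR⟩ := exists_notMem_of_finrank_lt (U := H) (W := ⊤)
    (by rw [finrank_top, Module.finrank_fin_fun, hH]; norm_num)
  obtain ⟨a, haR, hle⟩ := exists_linMap_of_notMem hR
  have ha : a ≠ 0 := by rintro rfl; simp [linMap_apply] at haR
  exact ⟨a, ha, Submodule.eq_of_le_of_finrank_eq hle (hH.trans (finrank_ker_linMap ha).symm)⟩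

lemma IsLine.exists_eq_ker_inf_ker {a : Fin 4 → K} (ha : a ≠ 0) {l : Submodule K (Fin 4 → K)}
    (hl : IsLine l) (hle : l ≤ LinearMap.ker (linMap a)) :
    ∃ m, LinearMap.ker (linMap a) ⊓ LinearMap.ker (linMap m) = l := by
  obtain ⟨R, hRa, hR⟩ := exists_notMem_of_finrank_lt (U := l) (W := LinearMap.ker (linMap a))
    (by rw [finrank_ker_linMap ha, hl]; norm_num)
  obtain ⟨m, hm, hlm⟩ := exists_linMap_of_notMem hR
  refine ⟨m, (Submodule.eq_of_le_of_finrank_le (le_inf hle hlm) ?_).symm⟩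
  have : Module.finrank K ↥(LinearMap.ker (linMap a) ⊓ LinearMap.ker (linMap m)) < 3 := by
    rw [← finrank_ker_linMap ha]
    exact Submodule.finrank_lt_finrank_of_lt
      (lt_of_le_of_ne inf_le_left fun h => hm (h.ge hRa).2)
  rw [hl]
  omega

lemma isLine_span_pair {R Q : Fin n → K} (hQ : Q ≠ 0) (hR : R ∉ Submodule.span K {Q}) :
    IsLine (Submodule.span K {R, Q}) := by
  rw [IsLine, Submodule.span_insert, sup_comm, finrank_sup_span_singleton hR,
    finrank_span_singleton hQ]

lemma eq_span_singleton_of_mem {U : Submodule K (Fin n → K)} (hU : Module.finrank K U = 1)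
    {v : Fin n → K} (hv : v ∈ U) (hv0 : v ≠ 0) : U = Submodule.span K {v} := by
  refine (Submodule.eq_of_le_of_finrank_eq ?_ ?_).symm
  · rwa [Submodule.span_singleton_le_iff_mem]
  · rw [finrank_span_singleton hv0, hU]

lemma exists_eq_span_singleton {U : Submodule K (Fin n → K)} (hU : Module.finrank K U = 1) :
    ∃ v, v ≠ 0 ∧ U = Submodule.span K {v} := by
  obtain ⟨v, hv, hv0⟩ := exists_notMem_of_finrank_lt (U := ⊥) (W := U) (by simp [hU])
  exact ⟨v, hv0, eq_span_singleton_of_mem hU hv hv0⟩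

open scoped Classical

variable [Fintype K]

/-- The lines of `H` on which `F` vanishes. -/
noncomputable def vanishingLines (F : MvPolynomial (Fin n) K) (H : Submodule K (Fin n → K)) :
    Finset (Submodule K (Fin n → K)) :=
  (Set.toFinite {l | l ≤ H ∧ IsLine l ∧ VanishesOn F l}).toFinset

lemma mem_vanishingLines {F : MvPolynomial (Fin n) K} {H l : Submodule K (Fin n → K)} :
    l ∈ vanishingLines F H ↔ l ≤ H ∧ IsLine l ∧ VanishesOn F l := by
  simp [vanishingLines]

lemma exists_mem_vanishingLines {F : MvPolynomial (Fin 4) K} (hF : F.IsHomogeneous d)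
    (hd2 : 2 ≤ d) (hdq : d ≤ Fintype.card K + 1) {H : Submodule K (Fin 4 → K)} (hH : IsPlane H)
    (hcard : Fintype.card K + d * (Fintype.card K ^ 2 - Fintype.card K) ≤ (zeros F H).card)
    {Q : Fin 4 → K} (hQH : Q ∈ H) (hQ0 : Q ≠ 0) (hQ : eval Q F = 0) :
    ∃ l ∈ vanishingLines F H, Q ∈ l := by
  by_contra! hno
  have h := card_zeros_add_le hF (by omega) hdq (k := 1) hH hQH hQ0 hQ fun R hR hRQ h0 =>
    hno (Submodule.span K {R, Q}) (mem_vanishingLines.mpr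
      ⟨Submodule.span_le.mpr (by rintro x (rfl | rfl) <;> assumption),
        isLine_span_pair hQ0 hRQ, vanishesOn_span_pair hF h0⟩)
      (Submodule.subset_span (by simp))
  have hq : 1 < Fintype.card K := Fintype.one_lt_card
  generalize Fintype.card K = q at *
  obtain ⟨e, rfl⟩ := Nat.exists_eq_add_of_le hd2
  obtain ⟨r, hr⟩ := Nat.exists_eq_add_of_le hdq
  obtain rfl : q = 1 + e + r := by omega
  have hsub : (1 + e + r) ^ 2 - (1 + e + r) = (1 + e + r) * (e + r) := by
    rw [Nat.sub_eq_iff_eq_add (by nlinarith)]; ring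
  rw [hsub] at hcard
  rw [show 2 + e - 1 = 1 + e by omega] at h
  have : (1 + e + r) * r + e ≤ 0 := by
    zify at *
    linear_combination h + hcard
  have hr0 : r = 0 := by
    by_contra hr0
    have := Nat.mul_pos (show 0 < 1 + e + r by omega) (Nat.pos_of_ne_zero hr0)
    omega
  omega

end Planes

section Pencils

open scoped Classical

variable {d : ℕ} [Fintype K]

lemma card_vectors_sdiff {U V W : Submodule K (Fin 4 → K)} {k : ℕ} (hU : U ≤ W) (hV : V ≤ W)
    (hUk : Module.finrank K U = k + 1) (hVk : Module.finrank K V = k + 1)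
    (hW : Module.finrank K W = k + 2) (hne : U ≠ V) :
    (vectors U \ vectors V).card = Fintype.card K ^ (k + 1) - Fintype.card K ^ k := by
  have h := finrank_inf_add_one hU hV hUk hVk hW hne
  rw [Finset.card_sdiff, Finset.inter_comm, vectors_inter, card_vectors, card_vectors, hUk,
    show Module.finrank K ↥(U ⊓ V) = k by omega]

lemma exists_isPencil_of_le_card_zeros {F : MvPolynomial (Fin 4) K} (hF : F.IsHomogeneous d)
    (hd2 : 2 ≤ d) (hdq : d ≤ Fintype.card K + 1) {H : Submodule K (Fin 4 → K)} (hH : IsPlane H)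
    (hnoplane : ¬ ∃ a : Fin 4 → K, a ≠ 0 ∧ linForm a ∣ F)
    (hcard : Fintype.card K + d * (Fintype.card K ^ 2 - Fintype.card K) ≤ (zeros F H).card) :
    ∃ P, IsPencil F d H P := by
  have hcover : ∀ Q ∈ H, Q ≠ 0 → eval Q F = 0 → ∃ l ∈ vanishingLines F H, Q ∈ l :=
    fun Q hQH hQ0 hQ => exists_mem_vanishingLines hF hd2 hdq hH hcard hQH hQ0 hQ
  obtain ⟨a, ha, rfl⟩ := hH.exists_eq_ker
  set H := LinearMap.ker (linMap a) with hHdef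
  set L := vanishingLines F H with hL
  have hq : 1 < Fintype.card K := Fintype.one_lt_card
  have hmex : ∀ l, ∃ m : Fin 4 → K, l ∈ L → H ⊓ LinearMap.ker (linMap m) = l := by
    intro l
    by_cases hl : l ∈ L
    · obtain ⟨h1, h2, -⟩ := mem_vanishingLines.mp hl
      obtain ⟨m, hm⟩ := h2.exists_eq_ker_inf_ker ha h1
      exact ⟨m, fun _ => hm⟩
    · exact ⟨0, fun h => absurd h hl⟩
  choose m hm using hmex
  obtain ⟨hrd, hprod⟩ := card_le_and_eq_prod_of_vanishesOn hF (by omega)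
    (fun h => hnoplane ⟨a, ha, h⟩) L m
    (fun l hl => by rw [← hHdef, hm l hl]; exact (mem_vanishingLines.mp hl).2.1)
    (fun l hl l' hl' h => by rw [← hHdef, hm l hl, hm l' hl']; exact h)
    (fun l hl => by rw [← hHdef, hm l hl]; exact (mem_vanishingLines.mp hl).2.2)
  have hsub : 1 ≤ Fintype.card K ^ 2 - Fintype.card K :=
    Nat.le_sub_of_add_le (by nlinarith)
  obtain ⟨l₀, hl₀⟩ : L.Nonempty := by
    obtain ⟨Q, hQ, hQ0⟩ := Finset.exists_mem_ne (s := zeros F H) (by nlinarith) 0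
    obtain ⟨l, hl, -⟩ := hcover Q (mem_zeros.mp hQ).1 hQ0 (mem_zeros.mp hQ).2
    exact ⟨l, hl⟩
  have hLH : ∀ l ∈ L, l ≤ H := fun l hl => (mem_vanishingLines.mp hl).1
  have hL2 : ∀ l ∈ L, Module.finrank K l = 2 := fun l hl => (mem_vanishingLines.mp hl).2.1
  have hdiff : ∀ l ∈ L.erase l₀, (vectors l \ vectors l₀).card =
      Fintype.card K ^ 2 - Fintype.card K := fun l hl => by
    have hl' := Finset.mem_of_mem_erase hl
    have := card_vectors_sdiff (k := 1) (hLH l hl') (hLH l₀ hl₀) (hL2 l hl') (hL2 l₀ hl₀) hH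
      (Finset.ne_of_mem_erase hl)
    rwa [pow_one] at this
  have hsubset : zeros F H ⊆
      vectors l₀ ∪ (L.erase l₀).biUnion fun l => vectors l \ vectors l₀ := by
    intro Q hQ
    simp only [Finset.mem_union, Finset.mem_biUnion, Finset.mem_sdiff, mem_vectors]
    by_cases hQl : Q ∈ l₀
    · exact Or.inl hQl
    · obtain ⟨l, hl, hQl'⟩ := hcover Q (mem_zeros.mp hQ).1
        (fun h => hQl (h ▸ l₀.zero_mem)) (mem_zeros.mp hQ).2
      exact Or.inr ⟨l, Finset.mem_erase.mpr ⟨fun h => hQl (h ▸ hQl'), hl⟩, hQl', hQl⟩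
  have hle := (Finset.card_le_card hsubset).trans (Finset.card_union_le _ _)
  have hl₀card : (vectors l₀).card =
      Fintype.card K + (Fintype.card K ^ 2 - Fintype.card K) := by
    rw [card_vectors, hL2 l₀ hl₀]; omega
  have hsum : ∑ l ∈ L.erase l₀, (vectors l \ vectors l₀).card =
      (L.card - 1) * (Fintype.card K ^ 2 - Fintype.card K) := by
    rw [Finset.sum_congr rfl hdiff, Finset.sum_const, smul_eq_mul, Finset.card_erase_of_mem hl₀]
  have hbi := Finset.card_biUnion_le (s := L.erase l₀) (t := fun l => vectors l \ vectors l₀)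
  have hLpos : 0 < L.card := Finset.card_pos.mpr ⟨l₀, hl₀⟩
  have hLcard : L.card = d := by
    refine le_antisymm hrd ?_
    rw [hsum] at hbi
    obtain ⟨r, hr⟩ := Nat.exists_eq_add_of_le hLpos
    rw [hr, Nat.succ_eq_add_one, Nat.add_sub_cancel_left] at hbi
    rw [hr]
    refine Nat.le_of_mul_le_mul_right ?_ hsub
    linarith
  have hdisj := pairwiseDisjoint_of_sum_card_le (L.erase l₀) (fun l => vectors l \ vectors l₀) (by
    rw [hsum, hLcard]
    obtain ⟨r, rfl⟩ := Nat.exists_eq_add_of_le' (show 1 ≤ d by omega)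
    rw [Nat.add_sub_cancel]
    linarith)
  obtain ⟨l₁, hl₁⟩ : (L.erase l₀).Nonempty := by
    rw [← Finset.card_pos, Finset.card_erase_of_mem hl₀]
    omega
  have hl₁' := Finset.mem_of_mem_erase hl₁
  have hinf : ∀ l ∈ L, ∀ l' ∈ L, l ≠ l' → Module.finrank K ↥(l ⊓ l') = 1 := fun l hl l' hl' h => by
    have := finrank_inf_add_one (hLH l hl) (hLH l' hl') (hL2 l hl) (hL2 l' hl') hH h
    omega
  obtain ⟨V, hV0, hV⟩ := exists_eq_span_singleton
    (hinf l₁ hl₁' l₀ hl₀ (Finset.ne_of_mem_erase hl₁))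
  have hVmem : V ∈ l₁ ⊓ l₀ := hV ▸ Submodule.mem_span_singleton_self V
  have hVL : ∀ l ∈ L, V ∈ l := by
    intro l hl
    by_cases h0 : l = l₀
    · exact h0 ▸ hVmem.2
    by_cases h1 : l = l₁
    · exact h1 ▸ hVmem.1
    have hd := hdisj hl₁ (Finset.mem_coe.mpr (Finset.mem_erase.mpr ⟨h0, hl⟩)) (Ne.symm h1)
    have hle' : l₁ ⊓ l ≤ l₁ ⊓ l₀ := by
      refine le_inf inf_le_left fun x hx => ?_
      by_contra hx0
      exact Finset.disjoint_left.mp hd (by simpa using ⟨hx.1, hx0⟩) (by simpa using ⟨hx.2, hx0⟩)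
    have := Submodule.eq_of_le_of_finrank_eq hle' ((hinf l₁ hl₁' l hl (Ne.symm h1)).trans
      (hinf l₁ hl₁' l₀ hl₀ (Finset.ne_of_mem_erase hl₁)).symm)
    exact (this.ge hVmem).2
  obtain ⟨c, g, hc, hFg⟩ := hprod hLcard
  let e : Fin d ≃ L := (L.equivFinOfCardEq hLcard).symm
  obtain ⟨u, hu⟩ := Projectivization.exists_smul_eq_mk_rep K V hV0
  refine ⟨Projectivization.mk K V hV0, a, fun i => m (e i), c, g, ha, hHdef, hc, ?_, ?_, ?_, ?_, ?_⟩
  · rw [hFg, ← Finset.prod_coe_sort L, ← e.prod_comp]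
  · intro i
    rw [← hHdef, hm _ (e i).2]
    exact hL2 _ (e i).2
  · intro i j hij
    rw [← hHdef, hm _ (e i).2, hm _ (e j).2]
    exact fun h => hij (e.injective (Subtype.ext h))
  · rw [← hu]
    exact H.smul_mem (u : K) (hLH l₀ hl₀ hVmem.2)
  · intro i
    have h : V ∈ H ⊓ LinearMap.ker (linMap (m (e i))) := by
      rw [hm _ (e i).2]
      exact hVL _ (e i).2
    rw [← hu, Units.smul_def, map_smul, LinearMap.mem_ker.mp h.2, smul_zero]

end Pencils

section PencilSections

open scoped Classical

variable {d : ℕ}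

lemma IsPencil.eval_add_smul {F : MvPolynomial (Fin 4) K} {H : Submodule K (Fin 4 → K)}
    {P : Projectivization K (Fin 4 → K)} (h : IsPencil F d H P) {R : Fin 4 → K} (hR : R ∈ H)
    (t : K) : eval (R + t • P.rep) F = eval R F := by
  obtain ⟨a, m, c, g, -, rfl, -, hF, -, -, hP, hmP⟩ := h
  have hR' : linMap a R = 0 := hR
  have hP' : linMap a P.rep = 0 := hP
  simp [hF, eval_linForm, hmP, hR', hP']

lemma linePoly_linForm (a R Q : Fin 4 → K) :
    linePoly (linForm a) R Q =
      Polynomial.C (linMap a R) + Polynomial.C (linMap a Q) * Polynomial.X := by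
  rw [linePoly, aeval_linForm, linMap_apply, linMap_apply, map_sum, map_sum, Finset.sum_mul,
    ← Finset.sum_add_distrib]
  refine Finset.sum_congr rfl fun i _ => ?_
  rw [← Polynomial.C_eq_algebraMap, Polynomial.C_mul, Polynomial.C_mul]
  ring

lemma linePoly_linForm_eq_zero_iff (a R Q : Fin 4 → K) :
    linePoly (linForm a) R Q = 0 ↔ linMap a R = 0 ∧ linMap a Q = 0 := by
  rw [linePoly_linForm]
  refine ⟨fun h => ⟨?_, ?_⟩, fun h => by simp [h.1, h.2]⟩
  · simpa using congrArg (Polynomial.coeff · 0) h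
  · simpa using congrArg (Polynomial.coeff · 1) h

lemma IsPencil.rep_mem_of_vanishesOn {F : MvPolynomial (Fin 4) K} {H : Submodule K (Fin 4 → K)}
    {P : Projectivization K (Fin 4 → K)} (h : IsPencil F d H P) {l : Submodule K (Fin 4 → K)}
    (hl : IsLine l) (hlH : l ≤ H) (hvan : VanishesOn F l) : P.rep ∈ l := by
  obtain ⟨a, m, c, g, -, rfl, hc, hF, hline, -, hP, hmP⟩ := h
  obtain ⟨R, Q, -, rfl⟩ := hl.exists_basis
  have hR : R ∈ Submodule.span K {R, Q} := Submodule.subset_span (by simp)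
  have hQ : Q ∈ Submodule.span K {R, Q} := Submodule.subset_span (by simp)
  have h0 := hvan R hR Q hQ
  have hmul : linePoly F R Q = Polynomial.C c * ∏ i, linePoly (linForm (m i)) R Q +
      linePoly (linForm a) R Q * linePoly g R Q := by
    rw [hF]
    simp only [linePoly, map_add, map_mul, map_prod, algHom_C]
    rfl
  rw [hmul, (linePoly_linForm_eq_zero_iff a R Q).mpr ⟨hlH hR, hlH hQ⟩, zero_mul, add_zero,
    mul_eq_zero, Finset.prod_eq_zero_iff] at h0
  obtain h0 | ⟨i, -, hi⟩ := h0
  · exact absurd (Polynomial.C_eq_zero.mp h0) hc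
  · rw [linePoly_linForm_eq_zero_iff] at hi
    have hle : Submodule.span K {R, Q} ≤
        LinearMap.ker (linMap a) ⊓ LinearMap.ker (linMap (m i)) := by
      refine le_inf hlH (Submodule.span_le.mpr ?_)
      rintro x (rfl | rfl)
      exacts [hi.1, hi.2]
    rw [Submodule.eq_of_le_of_finrank_eq hle (hl.trans (hline i).symm)]
    exact ⟨hP, hmP i⟩

lemma IsPencil.mem_span_rep {F : MvPolynomial (Fin 4) K} (hF : F.IsHomogeneous d)
    {H l : Submodule K (Fin 4 → K)} {P : Projectivization K (Fin 4 → K)} (hP : IsPencil F d H P)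
    (hH : IsPlane H) (hl : IsLine l) (hlH : l ≤ H) (hvan : VanishesOn F l) {Q R : Fin 4 → K}
    (hQl : Q ∈ l) (hQ0 : Q ≠ 0) (hRH : R ∈ H) (hRl : R ∉ l) (h0 : linePoly F R Q = 0) :
    Q ∈ Submodule.span K {P.rep} := by
  have hRQ : R ∉ Submodule.span K {Q} := fun h =>
    hRl ((Submodule.span_singleton_le_iff_mem Q l).mpr hQl h)
  have hl' := isLine_span_pair hQ0 hRQ
  have hl'H : Submodule.span K {R, Q} ≤ H := Submodule.span_le.mpr (by
    rintro x (rfl | rfl)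
    exacts [hRH, hlH hQl])
  have hR' : R ∈ Submodule.span K {R, Q} := Submodule.subset_span (by simp)
  have hQ' : Q ∈ Submodule.span K {R, Q} := Submodule.subset_span (by simp)
  have h1 := finrank_inf_add_one hlH hl'H hl hl' hH fun h => hRl (h ▸ hR')
  have h2 := eq_span_singleton_of_mem (by omega) (show P.rep ∈ l ⊓ Submodule.span K {R, Q} from
    ⟨hP.rep_mem_of_vanishesOn hl hlH hvan,
      hP.rep_mem_of_vanishesOn hl' hl'H (vanishesOn_span_pair hF h0)⟩) P.rep_nonzero
  exact h2 ▸ ⟨hQl, hQ'⟩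

lemma IsPencil.card_zeros [Fintype K] {F : MvPolynomial (Fin 4) K}
    {H : Submodule K (Fin 4 → K)} {P : Projectivization K (Fin 4 → K)} (h : IsPencil F d H P)
    (hd : d ≠ 0) : (zeros F H).card =
      Fintype.card K + d * (Fintype.card K ^ 2 - Fintype.card K) := by
  obtain ⟨a, m, c, g, ha, rfl, hc, hF, hline, hne, hP, hmP⟩ := h
  set l : Fin d → Submodule K (Fin 4 → K) := fun i =>
    LinearMap.ker (linMap a) ⊓ LinearMap.ker (linMap (m i)) with hl
  set U := Submodule.span K {P.rep} with hU
  have hU1 : Module.finrank K U = 1 := finrank_span_singleton P.rep_nonzero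
  have hUl : ∀ i, U ≤ l i := fun i => (Submodule.span_singleton_le_iff_mem _ _).mpr ⟨hP, hmP i⟩
  have hzero : ∀ v ∈ LinearMap.ker (linMap a), eval v F = 0 ↔ ∃ i, v ∈ l i := by
    intro v hv
    have hv' : linMap a v = 0 := hv
    simp only [hF, map_add, map_mul, eval_C, eval_prod, eval_linForm, hv', zero_mul, add_zero,
      mul_eq_zero, hc, false_or, Finset.prod_eq_zero_iff, Finset.mem_univ, true_and]
    exact exists_congr fun i => ⟨fun hi => ⟨hv, hi⟩, fun hi => hi.2⟩
  have hset : zeros F (LinearMap.ker (linMap a)) =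
      vectors U ∪ Finset.univ.biUnion fun i => vectors (l i) \ vectors U := by
    ext v
    simp only [mem_zeros, Finset.mem_union, Finset.mem_biUnion, Finset.mem_univ, true_and,
      Finset.mem_sdiff, mem_vectors]
    constructor
    · rintro ⟨hv, h0⟩
      obtain ⟨i, hi⟩ := (hzero v hv).mp h0
      by_cases hvU : v ∈ U
      exacts [Or.inl hvU, Or.inr ⟨i, hi, hvU⟩]
    · have key : ∀ i, v ∈ l i → v ∈ LinearMap.ker (linMap a) ∧ eval v F = 0 := fun i hi =>
        ⟨hi.1, (hzero v hi.1).mpr ⟨i, hi⟩⟩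
      rintro (hv | ⟨i, hi, -⟩)
      · exact key ⟨0, Nat.pos_of_ne_zero hd⟩ (hUl _ hv)
      · exact key i hi
  have hinf : ∀ i j, i ≠ j → l i ⊓ l j = U := by
    intro i j hij
    have h1 : Module.finrank K ↥(l i ⊓ l j) + 1 = 2 :=
      finrank_inf_add_one (inf_le_left : l i ≤ _) (inf_le_left : l j ≤ _)
        (hline i) (hline j) (finrank_ker_linMap ha) (hne i j hij)
    exact (Submodule.eq_of_le_of_finrank_eq (le_inf (hUl i) (hUl j)) (by omega)).symm
  rw [hset, Finset.card_union_of_disjoint, Finset.card_biUnion]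
  · have hcard : ∀ i, (vectors (l i) \ vectors U).card =
        Fintype.card K ^ 2 - Fintype.card K := fun i => by
      rw [Finset.card_sdiff_of_subset (vectors_mono (hUl i)), card_vectors, card_vectors, hU1,
        show Module.finrank K (l i) = 2 from hline i, pow_one]
    simp only [hcard, card_vectors, hU1, pow_one, Finset.sum_const, Finset.card_univ,
      Fintype.card_fin, smul_eq_mul]
  · intro i _ j _ hij
    refine Finset.disjoint_left.mpr fun x hi hj => ?_
    rw [Finset.mem_sdiff, mem_vectors, mem_vectors] at hi hj
    exact hi.2 (hinf i j hij ▸ ⟨hi.1, hj.1⟩)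
  · rw [Finset.disjoint_biUnion_right]
    exact fun i _ => Finset.disjoint_sdiff

end PencilSections

section VanishingLine

open scoped Classical

variable {d : ℕ} [Fintype K]

/-- The planes containing a given subspace. -/
noncomputable def planesThrough (l : Submodule K (Fin 4 → K)) :
    Finset (Submodule K (Fin 4 → K)) :=
  (Set.toFinite {H | IsPlane H ∧ l ≤ H}).toFinset

@[simp] lemma mem_planesThrough {l H : Submodule K (Fin 4 → K)} :
    H ∈ planesThrough l ↔ IsPlane H ∧ l ≤ H := by simp [planesThrough]

lemma sup_span_mem_planesThrough {l : Submodule K (Fin 4 → K)} (hl : IsLine l) {R : Fin 4 → K}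
    (hR : R ∉ l) : l ⊔ Submodule.span K {R} ∈ planesThrough l :=
  mem_planesThrough.mpr ⟨by rw [IsPlane, finrank_sup_span_singleton hR, hl], le_sup_left⟩

lemma eq_sup_span_of_mem_planesThrough {l H : Submodule K (Fin 4 → K)} (hl : IsLine l)
    (hH : H ∈ planesThrough l) {R : Fin 4 → K} (hRH : R ∈ H) (hR : R ∉ l) :
    l ⊔ Submodule.span K {R} = H := by
  obtain ⟨h1, h2⟩ := mem_planesThrough.mp hH
  refine Submodule.eq_of_le_of_finrank_eq
    (sup_le h2 ((Submodule.span_singleton_le_iff_mem R H).mpr hRH)) ?_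
  rw [finrank_sup_span_singleton hR, hl, h1]

lemma sum_card_zeros_add (F : MvPolynomial (Fin 4) K) {l : Submodule K (Fin 4 → K)}
    (hl : IsLine l) :
    ∑ H ∈ planesThrough l, (zeros F H).card + (zeros F l).card =
      (zeros F ⊤).card + (planesThrough l).card * (zeros F l).card := by
  have hsub : ∀ {U W : Submodule K (Fin 4 → K)}, U ≤ W → zeros F U ⊆ zeros F W :=
    fun h v hv => mem_zeros.mpr ⟨h (mem_zeros.mp hv).1, (mem_zeros.mp hv).2⟩
  have hunion : zeros F ⊤ \ zeros F l =
      (planesThrough l).biUnion fun H => zeros F H \ zeros F l := by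
    ext v
    simp only [Finset.mem_sdiff, mem_zeros, Submodule.mem_top, true_and, Finset.mem_biUnion]
    constructor
    · rintro ⟨hv, hvl⟩
      have hvl' : v ∉ l := fun h => hvl ⟨h, hv⟩
      exact ⟨_, sup_span_mem_planesThrough hl hvl',
        ⟨(le_sup_right : _ ≤ l ⊔ _) (Submodule.mem_span_singleton_self v), hv⟩, hvl⟩
    · rintro ⟨H, -, ⟨-, hv⟩, hvl⟩
      exact ⟨hv, hvl⟩
  have hcard : (zeros F ⊤ \ zeros F l).card =
      ∑ H ∈ planesThrough l, (zeros F H \ zeros F l).card := by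
    rw [hunion, Finset.card_biUnion]
    intro H hH H' hH' hne
    refine Finset.disjoint_left.mpr fun v hv hv' => hne ?_
    simp only [Finset.mem_sdiff, mem_zeros] at hv hv'
    have hvl : v ∉ l := fun h => hv.2 ⟨h, hv.1.2⟩
    rw [← eq_sup_span_of_mem_planesThrough hl hH hv.1.1 hvl,
      eq_sup_span_of_mem_planesThrough hl hH' hv'.1.1 hvl]
  have h1 := Finset.card_sdiff_add_card_eq_card (hsub (le_top : l ≤ ⊤))
  have h2 : ∑ H ∈ planesThrough l, (zeros F H).card =
      ∑ H ∈ planesThrough l, ((zeros F H \ zeros F l).card + (zeros F l).card) :=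
    Finset.sum_congr rfl fun H hH => (Finset.card_sdiff_add_card_eq_card
      (hsub (mem_planesThrough.mp hH).2)).symm
  rw [h2, Finset.sum_add_distrib, Finset.sum_const, smul_eq_mul]
  omega

lemma card_planesThrough {l : Submodule K (Fin 4 → K)} (hl : IsLine l) :
    (planesThrough l).card = Fintype.card K + 1 := by
  have hz : ∀ W : Submodule K (Fin 4 → K), (zeros 0 W).card =
      Fintype.card K ^ Module.finrank K W := fun W => by
    rw [← card_vectors]
    exact congrArg _ (by ext; simp)
  have h := sum_card_zeros_add 0 hl
  rw [Finset.sum_congr rfl fun H hH => (hz H).trans (by rw [(mem_planesThrough.mp hH).1]),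
    Finset.sum_const, hz, hz, hl, finrank_top, Module.finrank_fin_fun, smul_eq_mul] at h
  have hq : 1 < Fintype.card K := Fintype.one_lt_card
  generalize Fintype.card K = q at *
  obtain ⟨r, rfl⟩ := Nat.exists_eq_add_of_le hq
  have hpos : 0 < (r + 1) * (r + 2) ^ 2 := by positivity
  refine Nat.eq_of_mul_eq_mul_right hpos ?_
  zify at *
  linear_combination h

lemma VanishesOn.card_zeros {F : MvPolynomial (Fin 4) K} {l : Submodule K (Fin 4 → K)}
    (h : VanishesOn F l) : (zeros F l).card = Fintype.card K ^ Module.finrank K l := by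
  rw [← card_vectors, zeros, Finset.filter_true_of_mem]
  exact fun v hv => h.eval_eq_zero (mem_vectors.mp hv)

/-- Counts the zeros on a plane through a vanishing line `l` along the lines joining its points
to a point of `l`. -/
lemma card_affZeros_eq_of_forall_ne {F : MvPolynomial (Fin 4) K} (hF : F.IsHomogeneous d)
    (hd : 1 ≤ d) {H l : Submodule K (Fin 4 → K)} (hH : IsPlane H) (hl : IsLine l) (hlH : l ≤ H)
    (hvan : VanishesOn F l)
    (hcard : (zeros F H).card = Fintype.card K + d * (Fintype.card K ^ 2 - Fintype.card K))
    {Q : Fin 4 → K} (hQl : Q ∈ l) (hne : ∀ R ∈ H, R ∉ l → linePoly F R Q ≠ 0) :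
    ∀ R ∈ H, R ∉ l → (affZeros F R Q).card = d - 1 := by
  have hQ := hvan.eval_eq_zero hQl
  have hle : ∀ R ∈ vectors H, (affZeros F R Q).card ≤
      if R ∈ l then Fintype.card K else d - 1 := by
    intro R hR
    split_ifs with h
    · exact Finset.card_le_univ _
    · have h0 := hne R (mem_vectors.mp hR) h
      have := card_affZeros_le_natDegree h0
      have := natDegree_linePoly_lt hF hQ h0
      omega
  have hsum : ∑ R ∈ vectors H, (affZeros F R Q).card =
      ∑ R ∈ vectors H, if R ∈ l then Fintype.card K else d - 1 := by
    have hfl : (vectors H).filter (· ∈ l) = vectors l := by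
      ext v
      simpa using fun hv => hlH hv
    have hfn : ((vectors H).filter (· ∉ l)).card =
        Fintype.card K ^ 3 - Fintype.card K ^ 2 := by
      have : (vectors H).filter (· ∉ l) = vectors H \ vectors l := by ext; simp
      rw [this, Finset.card_sdiff_of_subset (vectors_mono hlH), card_vectors, card_vectors, hl, hH]
    rw [← card_mul_card_zeros F (hlH hQl), hcard, Finset.sum_ite, hfl, Finset.sum_const,
      Finset.sum_const, hfn, card_vectors, hl]
    obtain ⟨e, rfl⟩ := Nat.exists_eq_add_of_le hd
    have hq : 1 ≤ Fintype.card K := Fintype.card_pos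
    generalize Fintype.card K = q at *
    obtain ⟨r, rfl⟩ := Nat.exists_eq_add_of_le hq
    rw [Nat.add_sub_cancel_left, smul_eq_mul, smul_eq_mul]
    zify [Nat.pow_le_pow_right hq (show 2 ≤ 3 by norm_num),
      show 1 + r ≤ (1 + r) ^ 2 by nlinarith]
    ring
  have heq := (Finset.sum_eq_sum_iff_of_le hle).mp hsum
  intro R hR hRl
  rw [heq R (mem_vectors.mpr hR), if_neg hRl]

lemma IsPencil.card_affZeros_of_mem_span_rep {F : MvPolynomial (Fin 4) K}
    {H : Submodule K (Fin 4 → K)} {P : Projectivization K (Fin 4 → K)} (hP : IsPencil F d H P)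
    {Q R : Fin 4 → K} (hQ : Q ∈ Submodule.span K {P.rep}) (hR : R ∈ H)
    (hne : (affZeros F R Q).card ≠ Fintype.card K) : (affZeros F R Q).card = 0 := by
  obtain ⟨c, rfl⟩ := Submodule.mem_span_singleton.mp hQ
  have h : ∀ t : K, eval (R + t • c • P.rep) F = eval R F := fun t => by
    rw [smul_smul, hP.eval_add_smul hR]
  rw [Finset.card_eq_zero, affZeros, Finset.filter_eq_empty_iff]
  intro t _ ht
  refine hne ?_
  rw [affZeros, Finset.filter_true_of_mem, Finset.card_univ]
  intro s _
  rw [h, ← h t, ht]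

end VanishingLine

section PlaneCounts

open scoped Classical

variable {d : ℕ} [Fintype K]

lemma exists_vertex_plane {F : MvPolynomial (Fin 4) K} (hF : F.IsHomogeneous d) (hd2 : 2 ≤ d)
    {l : Submodule K (Fin 4 → K)} (hl : IsLine l) (hvan : VanishesOn F l)
    (hpen : ∀ H ∈ planesThrough l, ∃ P, IsPencil F d H P) {Q : Fin 4 → K} (hQl : Q ∈ l) :
    ∃ H ∈ planesThrough l, ∃ R ∈ H, R ∉ l ∧ linePoly F R Q = 0 := by
  obtain ⟨τ, hτ⟩ := exists_coeff_one_linePoly F Q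
  have hlτ : l ≤ LinearMap.ker τ := fun R hR => by
    rw [LinearMap.mem_ker, ← hτ, hvan Q hQl R hR, Polynomial.coeff_zero]
  obtain ⟨R, hRτ, hRl⟩ : ∃ R ∈ LinearMap.ker τ, R ∉ l := by
    refine exists_notMem_of_finrank_lt ?_
    have h2 := LinearMap.finrank_range_add_finrank_ker τ
    have h3 := Submodule.finrank_le (LinearMap.range τ)
    rw [Module.finrank_self] at h3
    rw [Module.finrank_fin_fun] at h2
    rw [hl]
    omega
  have hH := sup_span_mem_planesThrough hl hRl
  refine ⟨_, hH, ?_⟩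
  by_contra! hne
  obtain ⟨P, hP⟩ := hpen _ hH
  have hRH : R ∈ l ⊔ Submodule.span K {R} :=
    (le_sup_right : _ ≤ l ⊔ _) (Submodule.mem_span_singleton_self R)
  have h1 := card_affZeros_eq_of_forall_ne hF (by omega) (mem_planesThrough.mp hH).1 hl
    (mem_planesThrough.mp hH).2 hvan (hP.card_zeros (by omega)) hQl hne R hRH hRl
  have h0 := hne R hRH hRl
  have h2 := card_affZeros_le_natDegree h0
  have h3 := natDegree_linePoly_add_one_lt hF (hvan.eval_eq_zero hQl) ((hτ R).trans hRτ) h0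
  omega

lemma existsUnique_vertex_plane {F : MvPolynomial (Fin 4) K} (hF : F.IsHomogeneous d)
    (hd2 : 2 ≤ d) {l : Submodule K (Fin 4 → K)} (hl : IsLine l) (hvan : VanishesOn F l)
    (hpen : ∀ H ∈ planesThrough l, ∃ P, IsPencil F d H P) {Q : Fin 4 → K} (hQl : Q ∈ l)
    (hQ0 : Q ≠ 0) :
    ∃! H, H ∈ planesThrough l ∧ ∃ R ∈ H, R ∉ l ∧ linePoly F R Q = 0 := by
  let f : Submodule K (Fin 4 → K) → Finset (Fin 4 → K) := fun H =>
    ((vectors l).erase 0).filter fun Q => ∃ R ∈ H, R ∉ l ∧ linePoly F R Q = 0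
  have hf : ∀ H ∈ planesThrough l, (f H).card ≤ Fintype.card K - 1 := by
    intro H hH
    obtain ⟨P, hP⟩ := hpen H hH
    have hsub : f H ⊆ (vectors (Submodule.span K {P.rep})).erase 0 := by
      intro Q hQ
      simp only [f, Finset.mem_filter, Finset.mem_erase, mem_vectors] at hQ ⊢
      obtain ⟨⟨hQ0, hQl⟩, R, hRH, hRl, h0⟩ := hQ
      exact ⟨hQ0, hP.mem_span_rep hF (mem_planesThrough.mp hH).1 hl (mem_planesThrough.mp hH).2
        hvan hQl hQ0 hRH hRl h0⟩
    refine (Finset.card_le_card hsub).trans_eq ?_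
    rw [Finset.card_erase_of_mem (by simp), card_vectors, finrank_span_singleton P.rep_nonzero,
      pow_one]
  have hcover : (vectors l).erase 0 ⊆ (planesThrough l).biUnion f := by
    intro Q hQ
    have hQ' := hQ
    rw [Finset.mem_erase, mem_vectors] at hQ'
    obtain ⟨H, hH, hv⟩ := exists_vertex_plane hF hd2 hl hvan hpen hQ'.2
    exact Finset.mem_biUnion.mpr ⟨H, hH, Finset.mem_filter.mpr ⟨hQ, hv⟩⟩
  have hsum : ∑ H ∈ planesThrough l, (f H).card ≤ ((planesThrough l).biUnion f).card := by
    refine (Finset.sum_le_card_nsmul _ _ _ hf).trans (le_trans ?_ (Finset.card_le_card hcover))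
    rw [card_planesThrough hl, Finset.card_erase_of_mem (by simp), card_vectors, hl, smul_eq_mul,
      ← Nat.sq_sub_sq, one_pow]
  have hdisj := pairwiseDisjoint_of_sum_card_le _ _ hsum
  obtain ⟨H, hH, hv⟩ := exists_vertex_plane hF hd2 hl hvan hpen hQl
  refine ⟨H, ⟨hH, hv⟩, fun H' ⟨hH', hv'⟩ => ?_⟩
  by_contra hne
  have hQ : Q ∈ (vectors l).erase 0 := by simp [hQ0, hQl]
  exact Finset.disjoint_left.mp (hdisj hH' hH hne) (Finset.mem_filter.mpr ⟨hQ, hv'⟩)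
    (Finset.mem_filter.mpr ⟨hQ, hv⟩)

lemma card_zeros_of_not_isPencil {F : MvPolynomial (Fin 4) K} (hF : F.IsHomogeneous d)
    (hd2 : 2 ≤ d) (hdq : d ≤ Fintype.card K)
    (hpen : ∀ l, IsLine l → VanishesOn F l → ∀ H ∈ planesThrough l, ∃ P, IsPencil F d H P)
    {l : Submodule K (Fin 4 → K)} (hl : IsLine l) (hvan : VanishesOn F l)
    {H : Submodule K (Fin 4 → K)} (hH : IsPlane H) (hnot : ¬ ∃ P, IsPencil F d H P) :
    (zeros F H).card =
      Fintype.card K + (d - 1) * (Fintype.card K ^ 2 - Fintype.card K) := by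
  have hnl : ∀ l, IsLine l → VanishesOn F l → ¬ l ≤ H := fun l hl hvan hle =>
    hnot (hpen l hl hvan H (mem_planesThrough.mpr ⟨hH, hle⟩))
  have hinf : Module.finrank K ↥(l ⊓ H) = 1 := by
    have h1 := Submodule.finrank_sup_add_finrank_inf_eq l H
    have h2 := Submodule.finrank_le (l ⊔ H)
    have h3 : Module.finrank K ↥(l ⊓ H) < Module.finrank K l :=
      Submodule.finrank_lt_finrank_of_lt
        (lt_of_le_of_ne inf_le_left fun h => hnl l hl hvan (inf_eq_left.mp h))
    rw [Module.finrank_fin_fun] at h2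
    rw [hl] at h1 h3
    rw [hH] at h1
    omega
  obtain ⟨Q, hQ0, hlH⟩ := exists_eq_span_singleton hinf
  have hQ : Q ∈ l ⊓ H := hlH ▸ Submodule.mem_span_singleton_self Q
  have hQF := hvan.eval_eq_zero hQ.1
  obtain ⟨H₀, ⟨hH₀, R₀, hR₀H, hR₀l, hR₀⟩, huniq⟩ :=
    existsUnique_vertex_plane hF hd2 hl hvan (hpen l hl hvan) hQ.1 hQ0
  obtain ⟨P, hP⟩ := hpen l hl hvan H₀ hH₀
  have hQP := hP.mem_span_rep hF (mem_planesThrough.mp hH₀).1 hl (mem_planesThrough.mp hH₀).2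
    hvan hQ.1 hQ0 hR₀H hR₀l hR₀
  have hline : ∀ R ∈ H, R ∉ Submodule.span K {Q} → linePoly F R Q ≠ 0 := fun R hR hRQ h0 =>
    hnl _ (isLine_span_pair hQ0 hRQ) (vanishesOn_span_pair hF h0)
      (Submodule.span_le.mpr (by rintro x (rfl | rfl); exacts [hR, hQ.2]))
  have hterm : ∀ R ∈ vectors H, (affZeros F R Q).card =
      (if R ∈ Submodule.span K {Q} then Fintype.card K else 0) +
        if R ∈ H₀ then 0 else d - 1 := by
    intro R hR
    rw [mem_vectors] at hR
    have hQH₀ : Submodule.span K {Q} ≤ H₀ :=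
      (Submodule.span_singleton_le_iff_mem _ _).mpr ((mem_planesThrough.mp hH₀).2 hQ.1)
    by_cases hRQ : R ∈ Submodule.span K {Q}
    · rw [if_pos hRQ, if_pos (hQH₀ hRQ), card_affZeros_of_mem_span hF hQF hRQ, add_zero]
    rw [if_neg hRQ, zero_add]
    have hRl : R ∉ l := fun h => hRQ (hlH ▸ ⟨h, hR⟩)
    have h0 := hline R hR hRQ
    split_ifs with hRH₀
    · refine hP.card_affZeros_of_mem_span_rep hQP hRH₀ ?_
      have h2 := card_affZeros_le_natDegree h0
      have h3 := natDegree_linePoly_lt hF hQF h0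
      omega
    · have hH' := sup_span_mem_planesThrough hl hRl
      have hRH' : R ∈ l ⊔ Submodule.span K {R} :=
        (le_sup_right : _ ≤ l ⊔ _) (Submodule.mem_span_singleton_self R)
      obtain ⟨P', hP'⟩ := hpen l hl hvan _ hH'
      refine card_affZeros_eq_of_forall_ne hF (by omega) (mem_planesThrough.mp hH').1 hl
        (mem_planesThrough.mp hH').2 hvan (hP'.card_zeros (by omega)) hQ.1 ?_ R hRH' hRl
      intro R' hR' hR'l h0'
      exact hRH₀ (huniq _ ⟨hH', R', hR', hR'l, h0'⟩ ▸ hRH')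
  have hf1 : (vectors H).filter (· ∈ Submodule.span K {Q}) = vectors (Submodule.span K {Q}) := by
    ext v
    simp only [Finset.mem_filter, mem_vectors, and_iff_right_iff_imp]
    exact fun hv => (Submodule.span_singleton_le_iff_mem Q H).mpr hQ.2 hv
  have hf2 : ((vectors H).filter (· ∉ H₀)).card = Fintype.card K ^ 3 - Fintype.card K ^ 2 := by
    have : (vectors H).filter (· ∉ H₀) = vectors H \ vectors H₀ := by ext; simp
    rw [this, card_vectors_sdiff (k := 2) (W := ⊤) le_top le_top hH (mem_planesThrough.mp hH₀).1
      (by rw [finrank_top, Module.finrank_fin_fun]) (by rintro rfl; exact hnot ⟨P, hP⟩)]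
  have hq : 1 ≤ Fintype.card K := Fintype.card_pos
  refine Nat.eq_of_mul_eq_mul_left hq ?_
  rw [card_mul_card_zeros F hQ.2, Finset.sum_congr rfl hterm, Finset.sum_add_distrib,
    ← Finset.sum_filter, hf1, Finset.sum_ite, Finset.sum_const, Finset.sum_const, Finset.sum_const,
    hf2, card_vectors, finrank_span_singleton hQ0, smul_zero, zero_add, smul_eq_mul, smul_eq_mul]
  zify [Nat.pow_le_pow_right hq (show 2 ≤ 3 by norm_num),
    show Fintype.card K ≤ Fintype.card K ^ 2 by nlinarith]
  ring

lemma exists_vanishing_line {F : MvPolynomial (Fin 4) K} (hF : F.IsHomogeneous d) (hd2 : 2 ≤ d)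
    (hdq : d ≤ Fintype.card K + 1)
    (hcard : (zeros F ⊤).card = 1 + (Fintype.card K - 1) *
      ((d - 1) * Fintype.card K ^ 2 + d * Fintype.card K + 1)) :
    ∃ l, IsLine l ∧ VanishesOn F l := by
  have hq : 1 < Fintype.card K := Fintype.one_lt_card
  obtain ⟨Q, hQ, hQ0⟩ : ∃ Q ∈ zeros F ⊤, Q ≠ 0 := by
    refine Finset.exists_mem_ne ?_ 0
    rw [hcard, lt_add_iff_pos_right]
    have : 0 < Fintype.card K - 1 := by omega
    positivity
  by_contra! hno
  have h := card_zeros_add_le hF (by omega) hdq (k := 2) (W := ⊤)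
    (by rw [finrank_top, Module.finrank_fin_fun]) (mem_zeros.mp hQ).1 hQ0 (mem_zeros.mp hQ).2
    fun R _ hRQ h0 => hno _ (isLine_span_pair hQ0 hRQ) (vanishesOn_span_pair hF h0)
  rw [hcard] at h
  generalize Fintype.card K = q at *
  obtain ⟨e, rfl⟩ := Nat.exists_eq_add_of_le hd2
  obtain ⟨r, rfl⟩ := Nat.exists_eq_add_of_le hq
  rw [show 2 + e - 1 = e + 1 by omega, show Nat.succ 1 + r - 1 = r + 1 by omega,
    Nat.succ_eq_add_one] at h
  have he : (r + 1) * e ≤ (r + 1) * (r + 1) := Nat.mul_le_mul_left _ (by omega)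
  have hpos : 0 < (r + 1) * (r + 3) := by positivity
  refine hpos.not_ge ?_
  zify at *
  linear_combination h + he

lemma card_zeros_eq_of_not_isPencil {F : MvPolynomial (Fin 4) K} (hF : F.IsHomogeneous d)
    (hnoplane : ¬ ∃ a : Fin 4 → K, a ≠ 0 ∧ linForm a ∣ F) (hd2 : 2 ≤ d)
    (hdq : d ≤ Fintype.card K + 1)
    (hcard : (zeros F ⊤).card = 1 + (Fintype.card K - 1) *
      ((d - 1) * Fintype.card K ^ 2 + d * Fintype.card K + 1))
    {H : Submodule K (Fin 4 → K)} (hH : IsPlane H) (hnot : ¬ ∃ P, IsPencil F d H P) :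
    (zeros F H).card =
      Fintype.card K + (d - 1) * (Fintype.card K ^ 2 - Fintype.card K) := by
  have hpencil : ∀ H, IsPlane H →
      Fintype.card K + d * (Fintype.card K ^ 2 - Fintype.card K) ≤ (zeros F H).card →
      ∃ P, IsPencil F d H P := fun H hH =>
    exists_isPencil_of_le_card_zeros hF hd2 hdq hH hnoplane
  have hq : 1 < Fintype.card K := Fintype.one_lt_card
  obtain ⟨l, hl, hvan⟩ := exists_vanishing_line hF hd2 hdq hcard
  obtain hdq | rfl := Nat.le_or_eq_of_le_succ hdq
  · refine card_zeros_of_not_isPencil hF hd2 hdq ?_ hl hvan hH hnot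
    intro l hl hvan
    have hle : ∀ H ∈ planesThrough l, (zeros F H).card ≤
        Fintype.card K + d * (Fintype.card K ^ 2 - Fintype.card K) := by
      intro H hH
      by_contra! hlt
      obtain ⟨P, hP⟩ := hpencil H (mem_planesThrough.mp hH).1 hlt.le
      exact hlt.ne' (hP.card_zeros (by omega))
    have hsum := sum_card_zeros_add F hl
    rw [hvan.card_zeros, hl, hcard, card_planesThrough hl] at hsum
    have heq := (Finset.sum_eq_sum_iff_of_le hle).mp (by
      rw [Finset.sum_const, card_planesThrough hl, smul_eq_mul]
      obtain ⟨e, rfl⟩ := Nat.exists_eq_add_of_le hd2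
      rw [show 2 + e - 1 = e + 1 by omega] at hsum
      zify [hq.le, show Fintype.card K ≤ Fintype.card K ^ 2 by nlinarith] at hsum ⊢
      linear_combination hsum)
    exact fun H hH => hpencil H (mem_planesThrough.mp hH).1 (heq H hH).ge
  · refine absurd (hpencil H hH (le_of_eq ?_)) hnot
    have htop : (zeros F ⊤) = Finset.univ := by
      rw [← Finset.card_eq_iff_eq_univ, hcard, Fintype.card_fun, Fintype.card_fin,
        Nat.succ_eq_add_one, Nat.add_sub_cancel]
      zify [hq.le]
      ring
    have hHz : zeros F H = vectors H := by
      rw [zeros, Finset.filter_true_of_mem]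
      intro v _
      exact (mem_zeros.mp (htop ▸ Finset.mem_univ v)).2
    rw [hHz, card_vectors, hH]
    zify [show Fintype.card K ≤ Fintype.card K ^ 2 by nlinarith]
    ring

/-- A line with `k` rational points on the surface lies on exactly `k` pencil planes, in terms of
the number `1 + (q - 1) k` of zeros on the line. -/
lemma card_zeros_line {F : MvPolynomial (Fin 4) K} (hF : F.IsHomogeneous d)
    (hnoplane : ¬ ∃ a : Fin 4 → K, a ≠ 0 ∧ linForm a ∣ F) (hd2 : 2 ≤ d)
    (hdq : d ≤ Fintype.card K + 1)
    (hcard : (zeros F ⊤).card = 1 + (Fintype.card K - 1) *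
      ((d - 1) * Fintype.card K ^ 2 + d * Fintype.card K + 1))
    {l : Submodule K (Fin 4 → K)} (hl : IsLine l) :
    (zeros F l).card = 1 + (Fintype.card K - 1) *
      ((planesThrough l).filter fun H => ∃ P, IsPencil F d H P).card := by
  have hq : 1 < Fintype.card K := Fintype.one_lt_card
  have hsum := sum_card_zeros_add F hl
  have hterm : ∀ H ∈ planesThrough l, (zeros F H).card =
      Fintype.card K + (d - 1) * (Fintype.card K ^ 2 - Fintype.card K) +
        if ∃ P, IsPencil F d H P then Fintype.card K ^ 2 - Fintype.card K else 0 := by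
    intro H hH
    split_ifs with h
    · obtain ⟨P, hP⟩ := h
      rw [hP.card_zeros (by omega), add_assoc, ← Nat.succ_mul, Nat.succ_eq_add_one,
        Nat.sub_add_cancel (by omega)]
    · rw [add_zero]
      exact card_zeros_eq_of_not_isPencil hF hnoplane hd2 hdq hcard (mem_planesThrough.mp hH).1 h
  rw [Finset.sum_congr rfl hterm, Finset.sum_add_distrib, ← Finset.sum_filter, Finset.sum_const,
    Finset.sum_const, hcard, card_planesThrough hl, smul_eq_mul, smul_eq_mul] at hsum
  have hq0 : (Fintype.card K : ℤ) ≠ 0 := by positivity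
  zify [hq.le, show Fintype.card K ≤ Fintype.card K ^ 2 by nlinarith,
    show 1 ≤ d by omega] at hsum ⊢
  refine mul_left_cancel₀ hq0 ?_
  linear_combination -hsum

end PlaneCounts

section ProjectivePoints

open scoped Classical

variable {n d : ℕ} [Fintype K]

lemma card_zeros_eq_card_projectivization {F : MvPolynomial (Fin n) K} (hF : F.IsHomogeneous d)
    (hd : d ≠ 0) (W : Submodule K (Fin n → K)) :
    (zeros F W).card = 1 + (Fintype.card K - 1) *
      Nat.card {p : Projectivization K (Fin n → K) // p.rep ∈ W ∧ eval p.rep F = 0} := by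
  have h0 : (0 : Fin n → K) ∈ zeros F W := by
    have := hF.eval_smul' 0 0
    rw [zero_smul, zero_pow hd, zero_mul] at this
    exact mem_zeros.mpr ⟨W.zero_mem, this⟩
  let f : {p : Projectivization K (Fin n → K) // p.rep ∈ W ∧ eval p.rep F = 0} × Kˣ →
      (zeros F W).erase 0 := fun x => ⟨(x.2 : K) • x.1.1.rep, by
    rw [Finset.mem_erase, mem_zeros, hF.eval_smul', x.1.2.2, mul_zero]
    exact ⟨smul_ne_zero x.2.ne_zero x.1.1.rep_nonzero, W.smul_mem _ x.1.2.1, rfl⟩⟩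
  have hf : Function.Bijective f := by
    constructor
    · rintro ⟨⟨p, hp⟩, c⟩ ⟨⟨p', hp'⟩, c'⟩ h
      have h1 : (c : K) • p.rep = (c' : K) • p'.rep := congrArg Subtype.val h
      have hpp : p = p' := by
        rw [← p.mk_rep, ← p'.mk_rep, Projectivization.mk_eq_mk_iff]
        exact ⟨c⁻¹ * c', by rw [mul_smul, Units.smul_def c', ← h1, ← Units.smul_def,
          inv_smul_smul]⟩
      subst hpp
      have : c = c' := Units.ext (smul_left_injective K p.rep_nonzero h1)
      rw [this]
    · rintro ⟨v, hv⟩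
      rw [Finset.mem_erase, mem_zeros] at hv
      obtain ⟨hv0, hvW, hvF⟩ := hv
      obtain ⟨u, hu⟩ := Projectivization.exists_smul_eq_mk_rep K v hv0
      refine ⟨⟨⟨Projectivization.mk K v hv0, ?_, ?_⟩, u⁻¹⟩, Subtype.ext ?_⟩
      · rw [← hu]; exact W.smul_mem _ hvW
      · rw [← hu, Units.smul_def, hF.eval_smul', hvF, mul_zero]
      · change u⁻¹ • (Projectivization.mk K v hv0).rep = v
        rw [← hu, inv_smul_smul]
  have h1 := Nat.card_eq_of_bijective f hf
  rw [Nat.card_prod, Nat.card_units, Nat.card_eq_fintype_card (α := K),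
    Nat.card_eq_fintype_card (α := (zeros F W).erase 0), Fintype.card_coe,
    Finset.card_erase_of_mem h0, mul_comm] at h1
  have := Finset.card_pos.mpr ⟨0, h0⟩
  omega

end ProjectivePoints

/-- Let `S` be a surface of degree `d` (`2 ≤ d ≤ q+1`) in `P^3` over
`F_q` without `F_q`-plane components attaining the elementary bound. For every `F_q`-line
`l` of `P^3`, the number of `F_q`-points of `l` on `S` equals the number of `F_q`-planes
containing `l` whose section on `S` is a planar `F_q`-pencil of degree `d`. -/
theorem line_points_equal_pencil_planes (K : Type) [Field K] [Fintype K]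
    (d : ℕ) (F : MvPolynomial (Fin 4) K)
    (hhom : F.IsHomogeneous d) (hsf : Squarefree F)
    (hnoplane : ¬ ∃ a : Fin 4 → K, a ≠ 0 ∧ linForm a ∣ F)
    (hd2 : 2 ≤ d) (hdq : d ≤ Fintype.card K + 1)
    (hN : Nat.card {p : Projectivization K (Fin 4 → K) // MvPolynomial.eval p.rep F = 0} =
      (d - 1) * Fintype.card K ^ 2 + d * Fintype.card K + 1) :
    ∀ l : Submodule K (Fin 4 → K), IsLine l →
      Nat.card {p : Projectivization K (Fin 4 → K) //
          p.rep ∈ l ∧ MvPolynomial.eval p.rep F = 0} =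
      Nat.card {H : Submodule K (Fin 4 → K) //
          IsPlane H ∧ l ≤ H ∧ ∃ P, IsPencil F d H P} := by
  classical
  have hq : 1 < Fintype.card K := Fintype.one_lt_card
  have htop := card_zeros_eq_card_projectivization hhom (by omega) ⊤
  simp only [Submodule.mem_top, true_and] at htop
  rw [hN] at htop
  intro l hl
  have h1 := card_zeros_line hhom hnoplane hd2 hdq htop hl
  rw [card_zeros_eq_card_projectivization hhom (by omega) l, add_right_inj] at h1
  refine (Nat.eq_of_mul_eq_mul_left (by omega) h1).trans ?_
  exact (Nat.subtype_card _ (by simp [and_assoc])).symm
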